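/- arXiv:1611.05034 — 4 statements merged into one kernel-verified Lean document; each statement's English description precedes it below -/
import Mathlib

section
/- Let d ≥ 1, let q > d/2 be a real number, and let r ≥ 0 be an integer. Then there exists a constant C > 0 such that for every Schwartz function f : ℝ^d → ℂ and every x ∈ ℝ^d, the operator norm of the r-th iterated derivative of f at x satisfies ‖D^r f(x)‖ ≤ C ‖f‖_{H^{q+r}}. (This is the Sobolev embedding of H^{q+r}(ℝ^d) into C^r_0(ℝ^d), stated on the dense subspace of Schwartz functions.) -/
open MeasureTheory Complex
open scoped FourierTransform BigOperators

noncomputable section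

/-- Euclidean space `ℝ^d`. -/
abbrev Ed (d : ℕ) : Type := EuclideanSpace ℝ (Fin d)

/-- The Sobolev `H^s`-norm of a function on `ℝ^d`, defined via the Fourier transform:
`‖f‖_{H^s} = (∫ (1+‖ξ‖²)^s ‖𝓕f(ξ)‖² dξ)^{1/2}`. -/
noncomputable def HNorm {d : ℕ} (s : ℝ) (f : Ed d → ℂ) : ℝ :=
  (∫ ξ : Ed d, (1 + ‖ξ‖ ^ 2) ^ s * ‖𝓕 f ξ‖ ^ 2) ^ ((1 : ℝ) / 2)

open Real in
/-- The sup norm of the `r`-th derivative of a Schwartz function is controlled by the weighted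
`L¹`-norm of its Fourier transform. -/
theorem SchwartzMap.norm_iteratedFDeriv_le_integral_fourier {V : Type*} [NormedAddCommGroup V]
    [InnerProductSpace ℝ V] [FiniteDimensional ℝ V] [MeasurableSpace V] [BorelSpace V]
    (f : SchwartzMap V ℂ) (r : ℕ) (x : V) :
    ‖iteratedFDeriv ℝ r (⇑f) x‖ ≤ (2 * π) ^ r * ∫ ξ : V, ‖ξ‖ ^ r * ‖𝓕 (⇑f) ξ‖ := by
  set h : SchwartzMap V ℂ := 𝓕⁻ f with h_def
  have hf : (⇑f : V → ℂ) = 𝓕 (⇑h) := by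
    rw [← SchwartzMap.fourier_coe, h_def, FourierTransform.fourier_fourierInv_eq]
  have hh (ξ : V) : h ξ = 𝓕 (⇑f) (-ξ) := by
    rw [h_def, SchwartzMap.fourierInv_coe, Real.fourierInv_eq_fourier_neg]
  have hint : Integrable (fun ξ : V ↦ (2 * π) ^ r * (‖ξ‖ ^ r * ‖h ξ‖)) :=
    (h.integrable_pow_mul volume r).const_mul _
  calc ‖iteratedFDeriv ℝ r (⇑f) x‖
      ≤ ∫ ξ : V, ‖VectorFourier.fourierPowSMulRight (innerSL ℝ) (⇑h) ξ r‖ := by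
        rw [hf, Real.iteratedFDeriv_fourier (N := ⊤)
          (fun n _ ↦ h.integrable_pow_mul volume n) h.continuous.aestronglyMeasurable le_top]
        exact VectorFourier.norm_fourierIntegral_le_integral_norm _ _ _ _ _
    _ ≤ ∫ ξ : V, (2 * π) ^ r * (‖ξ‖ ^ r * ‖h ξ‖) := by
        refine integral_mono_of_nonneg (.of_forall fun _ ↦ norm_nonneg _) hint
          (.of_forall fun ξ ↦ ?_)
        refine (VectorFourier.norm_fourierPowSMulRight_le _ _ _ _).trans ?_
        rw [mul_assoc]
        beta_reduce
        gcongr ?_ ^ _ * _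
        exact mul_le_of_le_one_right two_pi_pos.le (norm_innerSL_le ℝ)
    _ = (2 * π) ^ r * ∫ ξ : V, ‖ξ‖ ^ r * ‖𝓕 (⇑f) ξ‖ := by
        rw [integral_const_mul, ← integral_neg_eq_self (fun ξ : V ↦ ‖ξ‖ ^ r * ‖𝓕 (⇑f) ξ‖)]
        simp only [hh, norm_neg]

/-- The product of a Schwartz function with a power of `1 + ‖x‖ ^ 2` is in every `L^p`. -/
theorem SchwartzMap.memLp_one_add_norm_sq_rpow_mul_norm {V : Type*} [NormedAddCommGroup V]
    [InnerProductSpace ℝ V] [FiniteDimensional ℝ V] [MeasurableSpace V] [BorelSpace V]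
    (g : SchwartzMap V ℂ) (s : ℝ) (p : ENNReal) :
    MemLp (fun ξ : V ↦ (1 + ‖ξ‖ ^ 2) ^ s * ‖g ξ‖) p := by
  have hs := Function.hasTemperateGrowth_one_add_norm_sq_rpow V s
  let G : SchwartzMap V ℂ := SchwartzMap.smulLeftCLM ℂ (fun ξ : V ↦ (1 + ‖ξ‖ ^ 2) ^ s) g
  refine (G.memLp p volume).norm.ae_eq (.of_forall fun ξ ↦ ?_)
  rw [SchwartzMap.smulLeftCLM_apply_apply hs g ξ, norm_smul,
    Real.norm_of_nonneg (by positivity)]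

/-- The weighted `L¹`-norm of the Fourier transform is controlled by a Sobolev norm. -/
theorem integral_pow_mul_norm_fourier_le_HNorm {d : ℕ} {q : ℝ} (hq : (d : ℝ) / 2 < q) (r : ℕ)
    (f : SchwartzMap (Ed d) ℂ) :
    ∫ ξ : Ed d, ‖ξ‖ ^ r * ‖𝓕 (⇑f) ξ‖ ≤
      (∫ ξ : Ed d, (1 + ‖ξ‖ ^ 2) ^ (-q)) ^ ((1 : ℝ) / 2) * HNorm (q + r) ⇑f := by
  set w : Ed d → ℝ := fun ξ ↦ (1 + ‖ξ‖ ^ 2) ^ (-q / 2)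
  set v : Ed d → ℝ := fun ξ ↦ (1 + ‖ξ‖ ^ 2) ^ ((q + r) / 2) * ‖𝓕 (⇑f) ξ‖
  have hw_sq (ξ : Ed d) : w ξ ^ (2 : ℝ) = (1 + ‖ξ‖ ^ 2) ^ (-q) := by
    rw [← Real.rpow_mul (by positivity), div_mul_cancel₀ _ two_ne_zero]
  have hv_sq (ξ : Ed d) : v ξ ^ (2 : ℝ) = (1 + ‖ξ‖ ^ 2) ^ (q + r) * ‖𝓕 (⇑f) ξ‖ ^ 2 := by
    rw [Real.mul_rpow (by positivity) (norm_nonneg _), ← Real.rpow_mul (by positivity),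
      div_mul_cancel₀ _ two_ne_zero, Real.rpow_two]
  have hw : MemLp w (ENNReal.ofReal 2) := by
    rw [ENNReal.ofReal_ofNat, memLp_two_iff_integrable_sq
      (by apply Measurable.aestronglyMeasurable; fun_prop)]
    have h := integrable_rpow_neg_one_add_norm_sq (E := Ed d) (μ := volume) (r := 2 * q)
      (by rw [finrank_euclideanSpace_fin]; linarith)
    refine h.congr (.of_forall fun ξ ↦ ?_)
    beta_reduce
    rw [← Real.rpow_two (w ξ), hw_sq]
    congr 1
    ring
  have hv : MemLp v (ENNReal.ofReal 2) := by
    have h := (𝓕 f).memLp_one_add_norm_sq_rpow_mul_norm ((q + r) / 2) (ENNReal.ofReal 2)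
    simpa only [SchwartzMap.fourier_coe] using h
  have hw_nonneg (ξ : Ed d) : 0 ≤ w ξ := by positivity
  have hv_nonneg (ξ : Ed d) : 0 ≤ v ξ := by positivity
  calc ∫ ξ : Ed d, ‖ξ‖ ^ r * ‖𝓕 (⇑f) ξ‖
      ≤ ∫ ξ : Ed d, w ξ * v ξ := by
        have : ENNReal.HolderConjugate (ENNReal.ofReal 2) (ENNReal.ofReal 2) := by
          rw [ENNReal.ofReal_ofNat]; infer_instance
        refine integral_mono_of_nonneg (.of_forall fun _ ↦ by positivity)
          (hw.integrable_mul hv) (.of_forall fun ξ ↦ ?_)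
        have h_pow : ‖ξ‖ ^ r ≤ (1 + ‖ξ‖ ^ 2) ^ ((r : ℝ) / 2) := by
          calc ‖ξ‖ ^ r = (‖ξ‖ ^ 2) ^ ((r : ℝ) / 2) := by
                rw [← Real.rpow_two, ← Real.rpow_mul (norm_nonneg _),
                  mul_div_cancel₀ _ two_ne_zero, Real.rpow_natCast]
            _ ≤ _ := by gcongr; linarith
        calc ‖ξ‖ ^ r * ‖𝓕 (⇑f) ξ‖ ≤ (1 + ‖ξ‖ ^ 2) ^ ((r : ℝ) / 2) * ‖𝓕 (⇑f) ξ‖ := by gcongr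
          _ = w ξ * v ξ := by
            rw [← mul_assoc, ← Real.rpow_add (by positivity)]
            congr 2
            ring
    _ ≤ (∫ ξ : Ed d, w ξ ^ (2 : ℝ)) ^ ((1 : ℝ) / 2) *
          (∫ ξ : Ed d, v ξ ^ (2 : ℝ)) ^ ((1 : ℝ) / 2) :=
        integral_mul_le_Lp_mul_Lq_of_nonneg Real.HolderConjugate.two_two
          (.of_forall hw_nonneg) (.of_forall hv_nonneg) hw hv
    _ = _ := by simp only [hw_sq, hv_sq, HNorm]

/-- Sobolev embedding: for `q > d/2` and `r : ℕ`, there is `C > 0` such that for every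
Schwartz function `f` and every `x`, `‖D^r f(x)‖ ≤ C ‖f‖_{H^{q+r}}`. -/
theorem sobolev_embedding_schwartz (d : ℕ) (hd : 1 ≤ d) (q : ℝ) (hq : (d : ℝ) / 2 < q)
    (r : ℕ) :
    ∃ C > 0, ∀ (f : SchwartzMap (Ed d) ℂ) (x : Ed d),
      ‖iteratedFDeriv ℝ r (⇑f) x‖ ≤ C * HNorm (q + r) ⇑f := by
  set A : ℝ := (∫ ξ : Ed d, (1 + ‖ξ‖ ^ 2) ^ (-q)) ^ ((1 : ℝ) / 2)
  have hA : 0 ≤ A := Real.rpow_nonneg (integral_nonneg fun _ ↦ by positivity) _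
  refine ⟨(2 * Real.pi) ^ r * A + 1, by positivity, fun f x ↦ ?_⟩
  have h_norm : 0 ≤ HNorm (q + r) ⇑f :=
    Real.rpow_nonneg (integral_nonneg fun _ ↦ by positivity) _
  calc ‖iteratedFDeriv ℝ r (⇑f) x‖
      ≤ (2 * Real.pi) ^ r * ∫ ξ : Ed d, ‖ξ‖ ^ r * ‖𝓕 (⇑f) ξ‖ :=
        f.norm_iteratedFDeriv_le_integral_fourier r x
    _ ≤ (2 * Real.pi) ^ r * (A * HNorm (q + r) ⇑f) := by
        gcongr
        exact integral_pow_mul_norm_fourier_le_HNorm hq r f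
    _ ≤ ((2 * Real.pi) ^ r * A + 1) * HNorm (q + r) ⇑f := by linarith
end
end

section
/- Let d ≥ 1 and let q, p be real numbers with q > d/2 and 0 ≤ p ≤ q. Then there exists a constant C > 0 such that for all Schwartz functions f, g : ℝ^d → ℂ, the pointwise product satisfies ‖f·g‖_{H^p} ≤ C ‖f‖_{H^q} ‖g‖_{H^p}. In particular (taking p = q), the H^q-norm is submultiplicative up to a constant when q > d/2. -/
open MeasureTheory Complex
open scoped FourierTransform BigOperators

noncomputable section

open scoped ENNReal

/-- The Cauchy-Schwarz inequality for lower Lebesgue integrals. -/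
lemma lintegral_mul_sq_le {α : Type*} [MeasurableSpace α] (μ : Measure α) {f g : α → ℝ≥0∞}
    (hf : AEMeasurable f μ) (hg : AEMeasurable g μ) :
    (∫⁻ x, f x * g x ∂μ) ^ 2 ≤ (∫⁻ x, f x ^ 2 ∂μ) * ∫⁻ x, g x ^ 2 ∂μ := by
  have h := ENNReal.lintegral_mul_le_Lp_mul_Lq μ Real.HolderConjugate.two_two hf hg
  simp only [Pi.mul_apply, ENNReal.rpow_two] at h
  refine (pow_le_pow_left' h 2).trans_eq ?_
  rw [mul_pow, ← ENNReal.rpow_two, ← ENNReal.rpow_two, ← ENNReal.rpow_mul, ← ENNReal.rpow_mul]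
  norm_num

/-- A weighted `L²` bound for convolutions, from a uniform bound on the convolution of the inverse
weights. -/
lemma lintegral_weight_mul_convolution_sq_le {E : Type*} [AddCommGroup E] [MeasurableSpace E]
    [MeasurableAdd₂ E] [MeasurableSub₂ E] (μ : Measure E) [SFinite μ] [μ.IsAddRightInvariant]
    {u v m F G : E → ℝ≥0∞} (hu : Measurable u) (hv : Measurable v)
    (hF : Measurable F) (hG : Measurable G) (hu0 : ∀ x, u x ≠ 0) (hut : ∀ x, u x ≠ ∞)
    (hv0 : ∀ x, v x ≠ 0) (hvt : ∀ x, v x ≠ ∞) {C : ℝ≥0∞}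
    (hC : ∀ x, m x * ∫⁻ y, (u y * v (x - y))⁻¹ ∂μ ≤ C) :
    ∫⁻ x, m x * (∫⁻ y, F y * G (x - y) ∂μ) ^ 2 ∂μ ≤
      C * ((∫⁻ x, u x * F x ^ 2 ∂μ) * ∫⁻ x, v x * G x ^ 2 ∂μ) := by
  have sq_sqrt (t : ℝ≥0∞) : (t ^ (1 / 2 : ℝ)) ^ 2 = t := by
    rw [← ENNReal.rpow_two, ← ENNReal.rpow_mul]; norm_num
  have key (x : E) : m x * (∫⁻ y, F y * G (x - y) ∂μ) ^ 2 ≤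
      C * ∫⁻ y, (u y * F y ^ 2) * (v (x - y) * G (x - y) ^ 2) ∂μ := by
    have hsplit (y : E) : F y * G (x - y) = ((u y * v (x - y))⁻¹) ^ (1 / 2 : ℝ) *
        ((u y * v (x - y)) ^ (1 / 2 : ℝ) * (F y * G (x - y))) := by
      rw [← mul_assoc, ← ENNReal.mul_rpow_of_nonneg _ _ (by norm_num),
        ENNReal.inv_mul_cancel (mul_ne_zero (hu0 _) (hv0 _)) (ENNReal.mul_ne_top (hut _) (hvt _)),
        ENNReal.one_rpow, one_mul]
    rw [lintegral_congr hsplit]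
    refine (mul_le_mul_right (lintegral_mul_sq_le μ (by fun_prop) (by fun_prop)) _).trans ?_
    simp_rw [mul_pow, sq_sqrt]
    rw [← mul_assoc]
    refine (mul_le_mul_left (hC x) _).trans_eq ?_
    congr 1
    refine lintegral_congr fun y => ?_
    ring
  refine (lintegral_mono key).trans ?_
  rw [lintegral_const_mul _ (by fun_prop), lintegral_lintegral_swap (by fun_prop)]
  refine mul_le_mul_right (le_of_eq ?_) _
  rw [← lintegral_mul_const _ (by fun_prop)]
  refine lintegral_congr fun y => ?_
  rw [lintegral_const_mul _ (by fun_prop),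
    lintegral_sub_right_eq_self (fun x => v x * G x ^ 2) y]

/-- The pointwise comparison of weights behind the multiplication estimate in Sobolev spaces. -/
lemma rpow_mul_rpow_neg_mul_rpow_neg_le {a b c p q : ℝ} (ha : 0 < a) (hb : 0 < b) (hc : 0 ≤ c)
    (h : c ≤ 2 * (a + b)) (hp : 0 ≤ p) (hpq : p ≤ q) :
    c ^ p * (a ^ (-q) * b ^ (-p)) ≤ 4 ^ p * (a ^ (-q) + b ^ (-q)) := by
  rcases le_total a b with hab | hab
  · calc c ^ p * (a ^ (-q) * b ^ (-p)) ≤ (4 * b) ^ p * (a ^ (-q) * b ^ (-p)) := by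
          gcongr; linarith
      _ = 4 ^ p * a ^ (-q) := by
          rw [Real.mul_rpow (by norm_num) hb.le, Real.rpow_neg hb.le p]
          have := (Real.rpow_pos_of_pos hb p).ne'
          field_simp
      _ ≤ _ := by gcongr; exact le_add_of_nonneg_right (by positivity)
  · calc c ^ p * (a ^ (-q) * b ^ (-p)) ≤ (4 * a) ^ p * (a ^ (-q) * b ^ (-p)) := by
          gcongr; linarith
      _ = 4 ^ p * (a ^ (p - q) * b ^ (-p)) := by
          rw [Real.mul_rpow (by norm_num) ha.le, sub_eq_add_neg, Real.rpow_add ha]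
          ring
      _ ≤ 4 ^ p * (b ^ (p - q) * b ^ (-p)) := by
          gcongr ?_ * (?_ * _)
          exact Real.rpow_le_rpow_of_nonpos hb hab (by linarith)
      _ = 4 ^ p * b ^ (-q) := by
          rw [← Real.rpow_add hb]; congr 2; ring
      _ ≤ _ := by gcongr; exact le_add_of_nonneg_left (by positivity)

/-- The Fourier transform of a product is the convolution of the Fourier transforms. -/
lemma SchwartzMap.fourier_mul_apply_eq_integral {d : ℕ} (f g : SchwartzMap (Ed d) ℂ) (ξ : Ed d) :
    𝓕 (fun x => f x * g x) ξ = ∫ η, 𝓕 (⇑f) η * 𝓕 (⇑g) (ξ - η) := by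
  set B := ContinuousLinearMap.mul ℂ ℂ
  have h : 𝓕 (SchwartzMap.pairing B f g) = SchwartzMap.convolution B (𝓕 f) (𝓕 g) := by
    have hinv : 𝓕⁻ (SchwartzMap.convolution B (𝓕 f) (𝓕 g)) = SchwartzMap.pairing B f g := by
      ext x
      have hF (k : SchwartzMap (Ed d) ℂ) (y : Ed d) : 𝓕⁻ k y = 𝓕 k (-y) := by
        rw [SchwartzMap.fourierInv_coe, SchwartzMap.fourier_coe, Real.fourierInv_eq_fourier_neg]
      rw [hF, SchwartzMap.fourier_convolution, SchwartzMap.pairing_apply_apply, ← hF, ← hF]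
      simp
    rw [← hinv, FourierTransform.fourier_fourierInv_eq]
  have h' := congrArg (fun k : SchwartzMap (Ed d) ℂ => k ξ) h
  simp only [SchwartzMap.convolution_apply, SchwartzMap.fourier_coe] at h'
  exact h'

lemma SchwartzMap.integrable_one_add_norm_sq_rpow_mul {d : ℕ} (s : ℝ)
    (f : SchwartzMap (Ed d) ℂ) :
    Integrable fun ξ : Ed d => (1 + ‖ξ‖ ^ 2) ^ s * ‖f ξ‖ ^ 2 := by
  have h := (SchwartzMap.pairing (ContinuousLinearMap.mul ℂ ℂ)
    (SchwartzMap.smulLeftCLM ℂ (fun x : Ed d => (1 + ‖x‖ ^ 2) ^ s) f) f).integrable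
      (μ := volume) |>.norm
  refine h.congr (.of_forall fun x => ?_)
  have hx : (0 : ℝ) ≤ (1 + ‖x‖ ^ 2) ^ s := by positivity
  simp only [SchwartzMap.pairing_apply_apply, ContinuousLinearMap.mul_apply', norm_mul]
  rw [SchwartzMap.smulLeftCLM_apply_apply (by fun_prop), norm_smul, Real.norm_of_nonneg hx]
  ring

lemma ofReal_one_add_norm_sq_rpow_mul {d : ℕ} (s : ℝ) (f : Ed d → ℂ) (ξ : Ed d) :
    ENNReal.ofReal ((1 + ‖ξ‖ ^ 2) ^ s * ‖f ξ‖ ^ 2) =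
      ENNReal.ofReal ((1 + ‖ξ‖ ^ 2) ^ s) * ‖f ξ‖ₑ ^ 2 := by
  rw [ENNReal.ofReal_mul (by positivity), ENNReal.ofReal_pow (norm_nonneg _), ofReal_norm]

/-- The convolution of the inverse Sobolev weights is bounded by the inverse of the smaller
weight. -/
lemma ofReal_rpow_mul_lintegral_inv_le {d : ℕ} {p q : ℝ} (hq : (d : ℝ) / 2 < q)
    (hp : 0 ≤ p) (hpq : p ≤ q) (x : Ed d) :
    ENNReal.ofReal ((1 + ‖x‖ ^ 2) ^ p) * ∫⁻ y : Ed d, (ENNReal.ofReal ((1 + ‖y‖ ^ 2) ^ q) *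
        ENNReal.ofReal ((1 + ‖x - y‖ ^ 2) ^ p))⁻¹ ≤
      ENNReal.ofReal (4 ^ p * (2 * ∫ y : Ed d, (1 + ‖y‖ ^ 2) ^ (-q))) := by
  have hint : Integrable fun y : Ed d => (1 + ‖y‖ ^ 2) ^ (-q) := by
    have := integrable_rpow_neg_one_add_norm_sq (E := Ed d) (μ := volume) (r := 2 * q)
      (by simp; linarith)
    convert! this using 3
    ring
  have hint' : Integrable fun y : Ed d => (1 + ‖x - y‖ ^ 2) ^ (-q) := hint.comp_sub_left x
  have hbound : ∫ y : Ed d, 4 ^ p * ((1 + ‖y‖ ^ 2) ^ (-q) + (1 + ‖x - y‖ ^ 2) ^ (-q)) =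
      4 ^ p * (2 * ∫ y : Ed d, (1 + ‖y‖ ^ 2) ^ (-q)) := by
    rw [integral_const_mul, integral_add hint hint',
      integral_sub_left_eq_self (fun y : Ed d => (1 + ‖y‖ ^ 2) ^ (-q)) volume x, two_mul]
  rw [← hbound, ofReal_integral_eq_lintegral_ofReal
      (f := fun y : Ed d => 4 ^ p * ((1 + ‖y‖ ^ 2) ^ (-q) + (1 + ‖x - y‖ ^ 2) ^ (-q)))
    ((hint.add hint').const_mul _)
    (.of_forall fun y => by positivity), ← lintegral_const_mul' _ _ ENNReal.ofReal_ne_top]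
  refine lintegral_mono fun y => ?_
  rw [← ENNReal.ofReal_mul (by positivity), ← ENNReal.ofReal_inv_of_pos (by positivity),
    ← ENNReal.ofReal_mul (by positivity)]
  refine ENNReal.ofReal_le_ofReal ?_
  rw [mul_inv, ← Real.rpow_neg (by positivity), ← Real.rpow_neg (by positivity)]
  refine rpow_mul_rpow_neg_mul_rpow_neg_le (by positivity) (by positivity) (by positivity) ?_ hp hpq
  have htri : ‖x‖ ≤ ‖y‖ + ‖x - y‖ := by simpa using norm_add_le y (x - y)
  nlinarith [norm_nonneg x, sq_nonneg (‖y‖ - ‖x - y‖), pow_le_pow_left₀ (norm_nonneg x) htri 2]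

/-- Pointwise multiplication estimate: for `q > d/2` and `0 ≤ p ≤ q`, there is `C > 0`
such that `‖f·g‖_{H^p} ≤ C ‖f‖_{H^q} ‖g‖_{H^p}` for all Schwartz functions `f, g`. -/
theorem pointwise_multiplication (d : ℕ) (hd : 1 ≤ d) (q p : ℝ) (hq : (d : ℝ) / 2 < q)
    (hp0 : 0 ≤ p) (hpq : p ≤ q) :
    ∃ C > 0, ∀ f g : SchwartzMap (Ed d) ℂ,
      HNorm p (fun x => f x * g x) ≤ C * HNorm q ⇑f * HNorm p ⇑g := by
  obtain ⟨K, hK, hconv⟩ : ∃ K : ℝ, 0 ≤ K ∧ ∀ x : Ed d, ENNReal.ofReal ((1 + ‖x‖ ^ 2) ^ p) *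
      ∫⁻ y : Ed d, (ENNReal.ofReal ((1 + ‖y‖ ^ 2) ^ q) *
        ENNReal.ofReal ((1 + ‖x - y‖ ^ 2) ^ p))⁻¹ ≤ ENNReal.ofReal K :=
    ⟨_, by positivity, ofReal_rpow_mul_lintegral_inv_le hq hp0 hpq⟩
  refine ⟨(K + 1) ^ (1 / 2 : ℝ), by positivity, fun f g => ?_⟩
  have hmul : ∫ ξ : Ed d, (1 + ‖ξ‖ ^ 2) ^ p * ‖𝓕 (fun x => f x * g x) ξ‖ ^ 2 ≤
      K * ((∫ ξ : Ed d, (1 + ‖ξ‖ ^ 2) ^ q * ‖𝓕 (⇑f) ξ‖ ^ 2) *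
        ∫ ξ : Ed d, (1 + ‖ξ‖ ^ 2) ^ p * ‖𝓕 (⇑g) ξ‖ ^ 2) := by
    have hf := SchwartzMap.integrable_one_add_norm_sq_rpow_mul q (𝓕 f)
    have hg := SchwartzMap.integrable_one_add_norm_sq_rpow_mul p (𝓕 g)
    have hfg : Integrable fun ξ : Ed d =>
        (1 + ‖ξ‖ ^ 2) ^ p * ‖𝓕 (fun x => f x * g x) ξ‖ ^ 2 :=
      SchwartzMap.integrable_one_add_norm_sq_rpow_mul p
        (𝓕 (SchwartzMap.pairing (ContinuousLinearMap.mul ℂ ℂ) f g))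
    have hfm : Measurable fun ξ => ‖𝓕 (⇑f) ξ‖ₑ := by
      rw [← SchwartzMap.fourier_coe]; exact (𝓕 f).continuous.measurable.enorm
    have hgm : Measurable fun ξ => ‖𝓕 (⇑g) ξ‖ₑ := by
      rw [← SchwartzMap.fourier_coe]; exact (𝓕 g).continuous.measurable.enorm
    rw [SchwartzMap.fourier_coe] at hf hg
    rw [← ENNReal.ofReal_le_ofReal_iff (by positivity), ENNReal.ofReal_mul hK,
      ENNReal.ofReal_mul (by positivity),
      ofReal_integral_eq_lintegral_ofReal hf (.of_forall fun y => by positivity),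
      ofReal_integral_eq_lintegral_ofReal hg (.of_forall fun y => by positivity),
      ofReal_integral_eq_lintegral_ofReal hfg (.of_forall fun y => by positivity)]
    simp_rw [ofReal_one_add_norm_sq_rpow_mul]
    have hw (s : ℝ) : Measurable fun ξ : Ed d => ENNReal.ofReal ((1 + ‖ξ‖ ^ 2) ^ s) := by
      fun_prop
    have hw0 (s : ℝ) (ξ : Ed d) : ENNReal.ofReal ((1 + ‖ξ‖ ^ 2) ^ s) ≠ 0 := by
      rw [ENNReal.ofReal_ne_zero_iff]; positivity
    refine le_trans (lintegral_mono fun ξ => ?_)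
      (lintegral_weight_mul_convolution_sq_le volume (hw q) (hw p) hfm hgm
        (hw0 q) (fun _ => ENNReal.ofReal_ne_top) (hw0 p) (fun _ => ENNReal.ofReal_ne_top) hconv)
    gcongr
    rw [SchwartzMap.fourier_mul_apply_eq_integral]
    refine (enorm_integral_le_lintegral_enorm _).trans_eq ?_
    simp_rw [enorm_mul]
  unfold HNorm
  rw [← Real.mul_rpow (by positivity) (by positivity), ← Real.mul_rpow (by positivity)
    (by positivity)]
  refine Real.rpow_le_rpow (by positivity) (hmul.trans ?_) (by norm_num)
  rw [mul_assoc]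
  gcongr
  linarith
end
end

section
/- Let d ≥ 1, let q > 1 + d/2 and 1 ≤ r ≤ q be real numbers, and let a : ℝ^d → ℂ be a symbol of class S^r, P := a(D). Then there exists a constant C > 0 such that for all Schwartz functions f, w : ℝ^d → ℂ, the commutator [f, P]w := f·(Pw) − P(f·w) satisfies ‖f·(Pw) − P(f·w)‖_{H^{q−r}} ≤ C ‖f‖_{H^q} ‖w‖_{H^{q−1}}. (This is the n = 1 case of the multilinear Kato–Ponce-type commutator estimate.) -/
open MeasureTheory Complex
open scoped FourierTransform BigOperators

noncomputable section

/-- A smooth function `a : ℝ^d → ℂ` is a symbol of class `S^r` if all its iterated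
derivatives of order `n` are bounded by a constant times `(1+‖ξ‖²)^{(r-n)/2}`. -/
def IsSymbolS {d : ℕ} (r : ℝ) (a : Ed d → ℂ) : Prop :=
  ContDiff ℝ (⊤ : ℕ∞) a ∧
    ∀ n : ℕ, ∃ C > 0, ∀ ξ : Ed d,
      ‖iteratedFDeriv ℝ n a ξ‖ ≤ C * (1 + ‖ξ‖ ^ 2) ^ ((r - n) / 2)

/-- The Fourier multiplier with symbol `a`: `a(D)f = 𝓕⁻¹(a · 𝓕f)`. -/
noncomputable def fm {d : ℕ} (a : Ed d → ℂ) (f : Ed d → ℂ) : Ed d → ℂ :=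
  𝓕⁻ (fun ξ => a ξ * 𝓕 f ξ)


namespace CommutatorEstimate

open scoped ENNReal SchwartzMap

variable {d : ℕ}

/-- The Japanese bracket `⟨ξ⟩ = (1 + ‖ξ‖²)^{1/2}`. -/
def bracket (ξ : Ed d) : ℝ := √(1 + ‖ξ‖ ^ 2)

lemma one_le_bracket (ξ : Ed d) : 1 ≤ bracket ξ :=
  Real.one_le_sqrt.2 (le_add_of_nonneg_right (sq_nonneg _))

lemma bracket_pos (ξ : Ed d) : 0 < bracket ξ := one_pos.trans_le (one_le_bracket ξ)

lemma norm_le_bracket (ξ : Ed d) : ‖ξ‖ ≤ bracket ξ :=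
  Real.le_sqrt_of_sq_le (by linarith)

lemma one_add_norm_sq_rpow (ξ : Ed d) (s : ℝ) :
    (1 + ‖ξ‖ ^ 2) ^ s = bracket ξ ^ (2 * s) := by
  rw [bracket, Real.rpow_mul (Real.sqrt_nonneg _), Real.rpow_two, Real.sq_sqrt (by positivity)]

lemma one_add_norm_sq_rpow_eq_sq (ξ : Ed d) (s : ℝ) :
    (1 + ‖ξ‖ ^ 2) ^ s = (bracket ξ ^ s) ^ 2 := by
  rw [one_add_norm_sq_rpow, mul_comm, Real.rpow_mul (bracket_pos ξ).le, Real.rpow_two]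

@[fun_prop]
lemma continuous_bracket : Continuous (bracket : Ed d → ℝ) := by
  unfold bracket; fun_prop

lemma continuous_bracket_rpow (s : ℝ) : Continuous fun ξ : Ed d => bracket ξ ^ s :=
  continuous_bracket.rpow_const fun ξ => Or.inl (bracket_pos ξ).ne'

lemma bracket_add_le (η ζ : Ed d) : bracket (η + ζ) ≤ bracket η + ‖ζ‖ := by
  have h1 : bracket η ^ 2 = 1 + ‖η‖ ^ 2 := Real.sq_sqrt (by positivity)
  refine Real.sqrt_le_iff.2 ⟨add_nonneg (bracket_pos η).le (norm_nonneg _), ?_⟩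
  have h2 : ‖η + ζ‖ ^ 2 ≤ (‖η‖ + ‖ζ‖) ^ 2 := by gcongr; exact norm_add_le _ _
  nlinarith [mul_le_mul_of_nonneg_right (norm_le_bracket η) (norm_nonneg ζ)]

lemma add_rpow_le_two_rpow_mul {x y s : ℝ} (hx : 0 ≤ x) (hy : 0 ≤ y) (hs : 0 ≤ s) :
    (x + y) ^ s ≤ 2 ^ s * (x ^ s + y ^ s) := by
  calc (x + y) ^ s ≤ (2 * max x y) ^ s := by
        gcongr; linarith [le_max_left x y, le_max_right x y]
    _ = 2 ^ s * (max x y) ^ s := Real.mul_rpow (by norm_num) (le_max_of_le_left hx)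
    _ ≤ 2 ^ s * (x ^ s + y ^ s) := by
        gcongr
        rcases max_choice x y with h | h <;> rw [h]
        · exact le_add_of_nonneg_right (Real.rpow_nonneg hy s)
        · exact le_add_of_nonneg_left (Real.rpow_nonneg hx s)

lemma _root_.IsSymbolS.hasTemperateGrowth {r : ℝ} {a : Ed d → ℂ} (ha : IsSymbolS r a) :
    a.HasTemperateGrowth := by
  refine ⟨ha.1, fun n => ?_⟩
  obtain ⟨C, hC, h⟩ := ha.2 n
  obtain ⟨k, hk⟩ := exists_nat_ge (r - n)
  refine ⟨k, C, fun ξ => (h ξ).trans ?_⟩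
  rw [one_add_norm_sq_rpow, mul_div_cancel₀ _ two_ne_zero, ← Real.rpow_natCast]
  gcongr
  calc bracket ξ ^ (r - n) ≤ bracket ξ ^ (k : ℝ) :=
        Real.rpow_le_rpow_of_exponent_le (one_le_bracket ξ) hk
    _ ≤ (1 + ‖ξ‖) ^ (k : ℝ) := by
        have := bracket_pos ξ
        gcongr
        refine Real.sqrt_le_iff.2 ⟨by positivity, ?_⟩
        nlinarith [norm_nonneg ξ]

/-- Mean value estimate for symbols of order at least one. -/
lemma _root_.IsSymbolS.exists_norm_sub_le {r : ℝ} {a : Ed d → ℂ} (ha : IsSymbolS r a)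
    (hr : 1 ≤ r) : ∃ C > 0, ∀ η ζ : Ed d,
      ‖a η - a (η + ζ)‖ ≤ C * (bracket η + ‖ζ‖) ^ (r - 1) * ‖ζ‖ := by
  obtain ⟨C, hC, h⟩ := ha.2 1
  refine ⟨C, hC, fun η ζ => ?_⟩
  rw [norm_sub_rev]
  have key := (convex_segment η (η + ζ)).norm_image_sub_le_of_norm_fderiv_le (𝕜 := ℝ) (f := a)
    (C := C * (bracket η + ‖ζ‖) ^ (r - 1))
    (fun x _ => (ha.1.differentiable (by simp)).differentiableAt) ?_
    (left_mem_segment ℝ _ _) (right_mem_segment ℝ _ _)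
  · simpa using key
  intro x hx
  rw [segment_eq_image'] at hx
  obtain ⟨t, ⟨ht0, ht1⟩, rfl⟩ := hx
  have h1 := h (η + t • (η + ζ - η))
  rw [norm_iteratedFDeriv_one, one_add_norm_sq_rpow, mul_div_cancel₀ _ two_ne_zero,
    Nat.cast_one, add_sub_cancel_left] at h1
  rw [add_sub_cancel_left]
  refine h1.trans ?_
  have := bracket_pos (η + t • ζ)
  gcongr
  refine (bracket_add_le _ _).trans ?_
  gcongr
  rw [norm_smul, Real.norm_of_nonneg ht0]
  exact mul_le_of_le_one_left (norm_nonneg _) ht1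

/-- The weighted kernel of the commutator splits into a low-high and a high-low part. -/
lemma _root_.IsSymbolS.exists_weighted_norm_sub_le {q r : ℝ} {a : Ed d → ℂ}
    (ha : IsSymbolS r a) (hr : 1 ≤ r) (hrq : r ≤ q) : ∃ C > 0, ∀ η ζ : Ed d,
      bracket (η + ζ) ^ (q - r) * ‖a η - a (η + ζ)‖ ≤
        C * (bracket ζ * bracket η ^ (q - 1) + bracket ζ ^ q) := by
  obtain ⟨C, hC, h⟩ := ha.exists_norm_sub_le hr
  refine ⟨C * 2 ^ (q - 1), by positivity, fun η ζ => ?_⟩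
  have hη := bracket_pos η
  have hζ := bracket_pos ζ
  have hηζ := bracket_pos (η + ζ)
  have hM : bracket η + ‖ζ‖ ≤ bracket η + bracket ζ := by gcongr; exact norm_le_bracket ζ
  calc bracket (η + ζ) ^ (q - r) * ‖a η - a (η + ζ)‖
      ≤ (bracket η + bracket ζ) ^ (q - r) *
          (C * (bracket η + bracket ζ) ^ (r - 1) * bracket ζ) := by
        gcongr
        · exact (bracket_add_le _ _).trans hM
        · refine (h η ζ).trans ?_
          gcongr
          exact norm_le_bracket ζ
    _ = C * bracket ζ * (bracket η + bracket ζ) ^ (q - 1) := by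
        rw [show q - 1 = (q - r) + (r - 1) by ring, Real.rpow_add (by positivity)]; ring
    _ ≤ C * bracket ζ * (2 ^ (q - 1) * (bracket η ^ (q - 1) + bracket ζ ^ (q - 1))) := by
        gcongr
        exact add_rpow_le_two_rpow_mul hη.le hζ.le (by linarith)
    _ = _ := by
        rw [show bracket ζ ^ q = bracket ζ ^ (q - 1) * bracket ζ by
          rw [← Real.rpow_add_one hζ.ne']; ring_nf]
        ring

lemma ennreal_rpow_half_sq (x : ℝ≥0∞) : (x ^ (1 / 2 : ℝ)) ^ 2 = x := by
  rw [← ENNReal.rpow_natCast, ← ENNReal.rpow_mul]; simp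

lemma ennreal_add_sq_le (x y : ℝ≥0∞) : (x + y) ^ 2 ≤ 4 * (x ^ 2 + y ^ 2) := by
  calc (x + y) ^ 2 ≤ (2 * max x y) ^ 2 := by
        rw [two_mul]; gcongr; exacts [le_max_left _ _, le_max_right _ _]
    _ = 4 * max x y ^ 2 := by rw [mul_pow]; norm_num
    _ ≤ 4 * (x ^ 2 + y ^ 2) := by
        gcongr
        rcases max_choice x y with h | h <;> rw [h]
        exacts [le_self_add, le_add_self]

/-- The Cauchy-Schwarz inequality. -/
lemma sq_lintegral_mul_le {α : Type*} [MeasurableSpace α] {μ : Measure α} {f g : α → ℝ≥0∞}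
    (hf : AEMeasurable f μ) (hg : AEMeasurable g μ) :
    (∫⁻ x, f x * g x ∂μ) ^ 2 ≤ (∫⁻ x, f x ^ 2 ∂μ) * ∫⁻ x, g x ^ 2 ∂μ := by
  have h := ENNReal.lintegral_mul_le_Lp_mul_Lq μ Real.HolderConjugate.two_two hf hg
  calc _ ≤ _ := pow_le_pow_left' h 2
    _ = _ := by
      rw [mul_pow, ennreal_rpow_half_sq, ennreal_rpow_half_sq]
      simp

/-- Young's inequality `‖g ⋆ h‖_2 ≤ ‖g‖_1 ‖h‖_2`, in squared form. -/
lemma lintegral_sq_convolution_le {g h : Ed d → ℝ≥0∞} (hg : Measurable g) (hh : Measurable h) :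
    ∫⁻ ξ, (∫⁻ η, g (ξ - η) * h η) ^ 2 ≤ (∫⁻ ζ, g ζ) ^ 2 * ∫⁻ η, h η ^ 2 := by
  have hpt (ξ : Ed d) : (∫⁻ η, g (ξ - η) * h η) ^ 2 ≤
      (∫⁻ ζ, g ζ) * ∫⁻ η, g (ξ - η) * h η ^ 2 := by
    have hgξ : Measurable fun η => g (ξ - η) := by fun_prop
    have := sq_lintegral_mul_le (μ := volume) (f := fun η => g (ξ - η) ^ (1 / 2 : ℝ))
      (g := fun η => g (ξ - η) ^ (1 / 2 : ℝ) * h η) (by fun_prop) (by fun_prop)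
    simp only [mul_pow, ennreal_rpow_half_sq, ← mul_assoc, ← sq] at this
    rwa [lintegral_sub_left_eq_self] at this
  calc ∫⁻ ξ, (∫⁻ η, g (ξ - η) * h η) ^ 2
      ≤ ∫⁻ ξ, (∫⁻ ζ, g ζ) * ∫⁻ η, g (ξ - η) * h η ^ 2 := lintegral_mono hpt
    _ = (∫⁻ ζ, g ζ) * ∫⁻ η, ∫⁻ ξ, g (ξ - η) * h η ^ 2 := by
        rw [lintegral_const_mul _ (by fun_prop), lintegral_lintegral_swap (by fun_prop)]
    _ = (∫⁻ ζ, g ζ) * ∫⁻ η, (∫⁻ ζ, g ζ) * h η ^ 2 := by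
        congr 2 with η
        rw [lintegral_mul_const _ (by fun_prop), lintegral_sub_right_eq_self]
    _ = _ := by rw [lintegral_const_mul _ (by fun_prop)]; ring

lemma lintegral_convolution_comm (g h : Ed d → ℝ≥0∞) (ξ : Ed d) :
    ∫⁻ η, g (ξ - η) * h η = ∫⁻ η, h (ξ - η) * g η := by
  rw [← lintegral_sub_left_eq_self _ ξ]
  simp [mul_comm]

/-- The weighted Fourier transform `⟨ξ⟩^s |𝓕 h (ξ)|`. -/
def weighted (s : ℝ) (h : 𝓢(Ed d, ℂ)) (ξ : Ed d) : ℝ≥0∞ :=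
  ENNReal.ofReal (bracket ξ ^ s) * ‖𝓕 h ξ‖ₑ

@[fun_prop]
lemma measurable_weighted (s : ℝ) (h : 𝓢(Ed d, ℂ)) : Measurable (weighted s h) :=
  (continuous_bracket_rpow s).measurable.ennreal_ofReal.mul (𝓕 h).continuous.measurable.enorm

lemma weighted_sq (s : ℝ) (h : 𝓢(Ed d, ℂ)) (ξ : Ed d) :
    weighted s h ξ ^ 2 = ENNReal.ofReal ((1 + ‖ξ‖ ^ 2) ^ s * ‖𝓕 h ξ‖ ^ 2) := by
  have := Real.rpow_nonneg (bracket_pos ξ).le s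
  rw [weighted, ← ofReal_norm, ← ENNReal.ofReal_mul this, ← ENNReal.ofReal_pow
    (by positivity), mul_pow, one_add_norm_sq_rpow_eq_sq]

lemma integrable_sobolev (s : ℝ) (h : 𝓢(Ed d, ℂ)) :
    Integrable fun ξ : Ed d => (1 + ‖ξ‖ ^ 2) ^ s * ‖𝓕 h ξ‖ ^ 2 := by
  have hg := Function.hasTemperateGrowth_one_add_norm_sq_rpow (Ed d) (s / 2)
  have := ((SchwartzMap.smulLeftCLM ℂ (fun x : Ed d => (1 + ‖x‖ ^ 2) ^ (s / 2)) (𝓕 h)).memLp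
    2 volume).integrable_norm_pow (by norm_num)
  refine this.congr (.of_forall fun ξ => ?_)
  have h0 : 0 ≤ (1 + ‖ξ‖ ^ 2) ^ (s / 2) := by positivity
  simp only [SchwartzMap.smulLeftCLM_apply_apply hg, norm_smul, Real.norm_of_nonneg h0]
  rw [mul_pow, ← Real.rpow_two ((1 + ‖ξ‖ ^ 2) ^ (s / 2)), ← Real.rpow_mul (by positivity),
    div_mul_cancel₀ _ two_ne_zero]

lemma hNorm_nonneg (s : ℝ) (f : Ed d → ℂ) : 0 ≤ HNorm s f :=
  Real.rpow_nonneg (integral_nonneg fun ξ => by positivity) _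

lemma ofReal_hNorm_sq (s : ℝ) (h : 𝓢(Ed d, ℂ)) :
    ENNReal.ofReal (HNorm s h) ^ 2 = ∫⁻ ξ, weighted s h ξ ^ 2 := by
  simp_rw [weighted_sq]
  rw [← ofReal_integral_eq_lintegral_ofReal (integrable_sobolev s h)
    (.of_forall fun ξ => by positivity), ← ENNReal.ofReal_pow (hNorm_nonneg s h), HNorm,
    ← Real.sqrt_eq_rpow, Real.sq_sqrt (integral_nonneg fun ξ => by positivity)]
  simp only [SchwartzMap.fourier_coe]

/-- Integrability of the weight in the Sobolev embedding. -/
lemma lintegral_bracket_rpow_lt_top {t : ℝ} (ht : (d : ℝ) / 2 < t) :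
    ∫⁻ ξ : Ed d, ENNReal.ofReal (bracket ξ ^ (-t)) ^ 2 < ∞ := by
  have h := (integrable_rpow_neg_one_add_norm_sq (E := Ed d) (μ := volume) (r := 2 * t)
    (by rw [finrank_euclideanSpace_fin]; linarith)).lintegral_lt_top
  refine lt_of_eq_of_lt (lintegral_congr fun ξ => ?_) h
  rw [← ENNReal.ofReal_pow (Real.rpow_nonneg (bracket_pos ξ).le _),
    ← one_add_norm_sq_rpow_eq_sq]
  ring_nf

lemma sq_lintegral_weighted_le (s t : ℝ) (h : 𝓢(Ed d, ℂ)) :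
    (∫⁻ ξ, weighted s h ξ) ^ 2 ≤
      (∫⁻ ξ : Ed d, ENNReal.ofReal (bracket ξ ^ (-t)) ^ 2) *
        ENNReal.ofReal (HNorm (s + t) h) ^ 2 := by
  rw [ofReal_hNorm_sq]
  refine le_of_eq_of_le ?_ (sq_lintegral_mul_le
    (continuous_bracket_rpow (-t)).measurable.ennreal_ofReal.aemeasurable
    (measurable_weighted _ _).aemeasurable)
  congr 2 with ξ
  rw [weighted, weighted, ← mul_assoc,
    ← ENNReal.ofReal_mul (Real.rpow_nonneg (bracket_pos ξ).le _),
    ← Real.rpow_add (bracket_pos ξ)]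
  ring_nf

lemma integrable_mul_comp_sub (f g : 𝓢(Ed d, ℂ)) (ξ : Ed d) :
    Integrable fun η => g η * f (ξ - η) := by
  refine g.integrable.mul_bdd (c := SchwartzMap.seminorm ℝ 0 0 f)
    (f.continuous.comp (by fun_prop)).aestronglyMeasurable
    (.of_forall fun η => SchwartzMap.norm_le_seminorm ℝ f _)

/-- The Fourier transform of a product is the convolution of the Fourier transforms. -/
lemma fourier_pairing_mul (f g : 𝓢(Ed d, ℂ)) (ξ : Ed d) :
    𝓕 (SchwartzMap.pairing (ContinuousLinearMap.mul ℂ ℂ) f g) ξ =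
      ∫ η, 𝓕 g η * 𝓕 f (ξ - η) := by
  set W := SchwartzMap.convolution (ContinuousLinearMap.mul ℂ ℂ) (𝓕 g) (𝓕 f) with hW
  have h1 : 𝓕⁻ W = SchwartzMap.pairing (ContinuousLinearMap.mul ℂ ℂ) f g := by
    ext x
    have h2 (u : 𝓢(Ed d, ℂ)) (x : Ed d) : 𝓕 u (-x) = 𝓕⁻ u x := by
      rw [SchwartzMap.fourierInv_coe, SchwartzMap.fourier_coe, Real.fourierInv_eq_fourier_neg]
    rw [← h2, hW, SchwartzMap.fourier_convolution, SchwartzMap.pairing_apply_apply, h2, h2]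
    simp [mul_comm]
  rw [← h1, FourierTransform.fourier_fourierInv_eq, hW, SchwartzMap.convolution_apply,
    convolution_def]
  rfl

/-- The commutator `[f, a(D)] w` as a Schwartz function. -/
def commutator (a : Ed d → ℂ) (f w : 𝓢(Ed d, ℂ)) : 𝓢(Ed d, ℂ) :=
  SchwartzMap.pairing (ContinuousLinearMap.mul ℂ ℂ) f (SchwartzMap.fourierMultiplierCLM ℂ a w) -
    SchwartzMap.fourierMultiplierCLM ℂ a
      (SchwartzMap.pairing (ContinuousLinearMap.mul ℂ ℂ) f w)

lemma coe_fourierMultiplierCLM {a : Ed d → ℂ} (ha : a.HasTemperateGrowth) (w : 𝓢(Ed d, ℂ)) :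
    ⇑(SchwartzMap.fourierMultiplierCLM ℂ a w) = fm a w := by
  rw [SchwartzMap.fourierMultiplierCLM_apply, SchwartzMap.fourierInv_coe,
    SchwartzMap.smulLeftCLM_apply ha]
  rfl

lemma coe_commutator {a : Ed d → ℂ} (ha : a.HasTemperateGrowth) (f w : 𝓢(Ed d, ℂ)) :
    ⇑(commutator a f w) = fun x => f x * fm a (⇑w) x - fm a (fun y => f y * w y) x := by
  ext x
  rw [commutator, sub_apply, coe_fourierMultiplierCLM ha,
    SchwartzMap.pairing_apply_apply, coe_fourierMultiplierCLM ha]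
  rfl

lemma fourier_fourierMultiplierCLM {a : Ed d → ℂ} (ha : a.HasTemperateGrowth)
    (w : 𝓢(Ed d, ℂ)) (ξ : Ed d) :
    𝓕 (SchwartzMap.fourierMultiplierCLM ℂ a w) ξ = a ξ * 𝓕 w ξ := by
  rw [SchwartzMap.fourierMultiplierCLM_apply, FourierTransform.fourier_fourierInv_eq,
    SchwartzMap.smulLeftCLM_apply_apply ha, smul_eq_mul]

lemma fourier_commutator {a : Ed d → ℂ} (ha : a.HasTemperateGrowth) (f w : 𝓢(Ed d, ℂ))
    (ξ : Ed d) :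
    𝓕 (commutator a f w) ξ = ∫ η, (a η - a ξ) * (𝓕 w η * 𝓕 f (ξ - η)) := by
  have h1 := integrable_mul_comp_sub (𝓕 f) (𝓕 (SchwartzMap.fourierMultiplierCLM ℂ a w)) ξ
  have h2 := (integrable_mul_comp_sub (𝓕 f) (𝓕 w) ξ).const_mul (a ξ)
  rw [commutator, ← FourierTransform.fourierCLM_apply (R := ℂ), map_sub,
    FourierTransform.fourierCLM_apply, FourierTransform.fourierCLM_apply, sub_apply, fourier_pairing_mul,
    fourier_fourierMultiplierCLM ha, fourier_pairing_mul, ← integral_const_mul,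
    ← integral_sub h1 h2]
  congr with η
  rw [fourier_fourierMultiplierCLM ha]
  ring

/-- Pointwise bound of the Fourier transform of the commutator by two convolutions. -/
lemma _root_.IsSymbolS.exists_weighted_commutator_le {q r : ℝ} {a : Ed d → ℂ}
    (ha : IsSymbolS r a) (hr : 1 ≤ r) (hrq : r ≤ q) : ∃ C > 0, ∀ (f w : 𝓢(Ed d, ℂ)) (ξ : Ed d),
      weighted (q - r) (commutator a f w) ξ ≤ ENNReal.ofReal C *
        ((∫⁻ η, weighted 1 f (ξ - η) * weighted (q - 1) w η) +
          ∫⁻ η, weighted q f (ξ - η) * weighted 0 w η) := by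
  obtain ⟨C, hC, h⟩ := ha.exists_weighted_norm_sub_le hr hrq
  refine ⟨C, hC, fun f w ξ => ?_⟩
  rw [weighted, fourier_commutator ha.hasTemperateGrowth, ← lintegral_add_left (by fun_prop),
    ← lintegral_const_mul _ (by fun_prop)]
  refine (mul_le_mul_right (enorm_integral_le_lintegral_enorm _) _).trans ?_
  rw [← lintegral_const_mul' _ _ ENNReal.ofReal_ne_top]
  refine lintegral_mono fun η => ?_
  have hη := bracket_pos η
  have hζ := bracket_pos (ξ - η)
  have hξ := bracket_pos ξ
  have key := h η (ξ - η)
  rw [add_sub_cancel] at key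
  simp only [weighted, ← ofReal_norm, norm_mul]
  rw [← ENNReal.ofReal_mul (by positivity), ← ENNReal.ofReal_mul (by positivity),
    ← ENNReal.ofReal_mul (by positivity), ← ENNReal.ofReal_mul (by positivity),
    ← ENNReal.ofReal_mul (by positivity), ← ENNReal.ofReal_mul (by positivity),
    ← ENNReal.ofReal_mul (by positivity), ← ENNReal.ofReal_add (by positivity) (by positivity),
    ← ENNReal.ofReal_mul hC.le]
  refine ENNReal.ofReal_le_ofReal ?_
  have := mul_le_mul_of_nonneg_right key
    (mul_nonneg (norm_nonneg (𝓕 w η)) (norm_nonneg (𝓕 f (ξ - η))))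
  rw [Real.rpow_one, Real.rpow_zero]
  calc _ = _ := by ring
    _ ≤ _ := this
    _ = _ := by ring

end CommutatorEstimate

open CommutatorEstimate in
/-- Commutator estimate (Kato–Ponce type, `n = 1` case): for a symbol `a` of class `S^r`,
`‖[f, a(D)]w‖_{H^{q-r}} ≤ C ‖f‖_{H^q} ‖w‖_{H^{q-1}}`. -/
theorem commutator_estimate (d : ℕ) (hd : 1 ≤ d) (q r : ℝ)
    (hq : 1 + (d : ℝ) / 2 < q) (hr1 : 1 ≤ r) (hrq : r ≤ q)
    (a : Ed d → ℂ) (ha : IsSymbolS r a) :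
    ∃ C > 0, ∀ f w : SchwartzMap (Ed d) ℂ,
      HNorm (q - r) (fun x => f x * fm a (⇑w) x - fm a (fun y => f y * w y) x)
        ≤ C * HNorm q ⇑f * HNorm (q - 1) ⇑w := by
  obtain ⟨C, hC, h⟩ := ha.exists_weighted_commutator_le hr1 hrq
  have hK := lintegral_bracket_rpow_lt_top (d := d) (t := q - 1) (by linarith)
  set K := ∫⁻ ξ : Ed d, ENNReal.ofReal (bracket ξ ^ (-(q - 1))) ^ 2
  set κ := K.toReal + 1
  have hκ : 1 ≤ κ := le_add_of_nonneg_left ENNReal.toReal_nonneg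
  have hKκ : K ≤ ENNReal.ofReal κ ^ 2 := by
    rw [← ENNReal.ofReal_pow (by positivity)]
    refine (ENNReal.le_ofReal_iff_toReal_le hK.ne (by positivity)).2 ?_
    nlinarith
  refine ⟨3 * C * κ, by positivity, fun f w => ?_⟩
  rw [← coe_commutator ha.hasTemperateGrowth]
  have hf0 := hNorm_nonneg q f
  have hw0 := hNorm_nonneg (q - 1) w
  rw [← ENNReal.ofReal_le_ofReal_iff (by positivity), ← ENNReal.pow_le_pow_left_iff two_ne_zero,
    ofReal_hNorm_sq, ENNReal.ofReal_mul (by positivity), ENNReal.ofReal_mul (by positivity),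
    ENNReal.ofReal_mul (by positivity), ENNReal.ofReal_mul (by positivity)]
  set F := ENNReal.ofReal (HNorm q f)
  set W := ENNReal.ofReal (HNorm (q - 1) w)
  have hI₁ : ∫⁻ ξ, (∫⁻ η, weighted 1 f (ξ - η) * weighted (q - 1) w η) ^ 2 ≤ K * F ^ 2 * W ^ 2 := by
    refine (lintegral_sq_convolution_le (by fun_prop) (by fun_prop)).trans ?_
    rw [← ofReal_hNorm_sq]
    gcongr
    simpa only [add_sub_cancel] using sq_lintegral_weighted_le 1 (q - 1) f
  have hI₂ : ∫⁻ ξ, (∫⁻ η, weighted q f (ξ - η) * weighted 0 w η) ^ 2 ≤ K * F ^ 2 * W ^ 2 := by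
    simp_rw [lintegral_convolution_comm (weighted q f)]
    refine (lintegral_sq_convolution_le (by fun_prop) (by fun_prop)).trans ?_
    rw [← ofReal_hNorm_sq, mul_right_comm]
    gcongr
    simpa only [zero_add] using sq_lintegral_weighted_le 0 (q - 1) w
  calc ∫⁻ ξ, weighted (q - r) (commutator a f w) ξ ^ 2
      ≤ ∫⁻ ξ, ENNReal.ofReal C ^ 2 * (4 *
          ((∫⁻ η, weighted 1 f (ξ - η) * weighted (q - 1) w η) ^ 2 +
            (∫⁻ η, weighted q f (ξ - η) * weighted 0 w η) ^ 2)) := by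
        refine lintegral_mono fun ξ => (pow_le_pow_left' (h f w ξ) 2).trans ?_
        rw [mul_pow]
        gcongr
        exact ennreal_add_sq_le _ _
    _ = ENNReal.ofReal C ^ 2 * (4 *
          ((∫⁻ ξ, (∫⁻ η, weighted 1 f (ξ - η) * weighted (q - 1) w η) ^ 2) +
            ∫⁻ ξ, (∫⁻ η, weighted q f (ξ - η) * weighted 0 w η) ^ 2)) := by
        rw [lintegral_const_mul' _ _ (by finiteness), lintegral_const_mul' _ _ (by finiteness),
          lintegral_add_left]
        exact (Measurable.lintegral_prod_right' (f := fun p : Ed d × Ed d =>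
          weighted 1 f (p.1 - p.2) * weighted (q - 1) w p.2) (by fun_prop)).pow_const 2
    _ ≤ ENNReal.ofReal C ^ 2 * (4 * (ENNReal.ofReal κ ^ 2 * F ^ 2 * W ^ 2 +
          ENNReal.ofReal κ ^ 2 * F ^ 2 * W ^ 2)) := by
        gcongr
        · exact hI₁.trans (by gcongr)
        · exact hI₂.trans (by gcongr)
    _ = 8 * (ENNReal.ofReal C * ENNReal.ofReal κ * F * W) ^ 2 := by ring
    _ ≤ 9 * (ENNReal.ofReal C * ENNReal.ofReal κ * F * W) ^ 2 := by gcongr; norm_num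
    _ = _ := by
        rw [show ENNReal.ofReal 3 = 3 by simp]
        ring
end
end

section
/- Let d ≥ 1, n ≥ 1 an integer, let q > 1 + d/2 and 1 ≤ r ≤ q be real numbers, and let p : ℝ^d → ℂ be a symbol of class S^{r+n−1}, P := p(D). For Schwartz functions f₁, …, f_n define the iterated commutator operators recursively by S_{0,P} := P and S_{k,P}(f₁,…,f_k)w := f₁·(S_{k−1,P}(f₂,…,f_k)w) − S_{k−1,P}(f₂,…,f_k)(f₁·w), i.e. S_{n,P}(f₁,…,f_n) = [f₁,[f₂,[…[f_n, P]…]]] where [f, Q] denotes the commutator of multiplication by f with the operator Q. Then there exists a constant C > 0 such that for all Schwartz functions f₁, …, f_n, w : ℝ^d → ℂ, ‖S_{n,P}(f₁,…,f_n)w‖_{H^{q−r}} ≤ C ‖f₁‖_{H^q} ⋯ ‖f_n‖_{H^q} ‖w‖_{H^{q−1}}. -/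
open MeasureTheory Complex
open scoped FourierTransform BigOperators

noncomputable section

/-- Iterated commutators of multiplication operators with an operator `P`:
`iterComm P [f₁,…,fₙ] = [f₁,[f₂,[…[fₙ, P]…]]]`. -/
noncomputable def iterComm {d : ℕ} (P : (Ed d → ℂ) → Ed d → ℂ) :
    List (Ed d → ℂ) → (Ed d → ℂ) → Ed d → ℂ
  | [], w => P w
  | f :: fs, w => fun x => f x * iterComm P fs w x - iterComm P fs (fun y => f y * w y) x

universe u

section Kernel

variable {E : Type u} [NormedAddCommGroup E] [InnerProductSpace ℝ E] [FiniteDimensional ℝ E]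
  [MeasurableSpace E] [BorelSpace E]

/-- The Fourier-side representation of an iterated commutator: if the `fᵢ` and `g` are the
Fourier transforms of `uᵢ` and `w`, this is the Fourier transform of `[u₁,[…[uₙ, p(D)]…]]w`. -/
def commKernel : List (SchwartzMap E ℂ) → (E → ℂ) → (E → ℂ) → E → ℂ
  | [], p, g, ξ => p ξ * g ξ
  | f :: fs, p, g, ξ => ∫ ζ, f ζ * commKernel fs (fun η => p η - p (η + ζ)) g (ξ - ζ)

/-- A measurable function bounded by `B * (1 + ‖x‖) ^ m`. -/
def PolyBound (m : ℕ) (B : ℝ) (p : E → ℂ) : Prop :=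
  Measurable p ∧ ∀ x, ‖p x‖ ≤ B * (1 + ‖x‖) ^ m

/-- A measurable function bounded by `G * (1 + ‖x‖) ^ (-m)`. -/
def PolyDecay (m : ℕ) (G : ℝ) (g : E → ℂ) : Prop :=
  Measurable g ∧ ∀ x, ‖g x‖ * (1 + ‖x‖) ^ m ≤ G

/-- The constant in the uniform bound for `commKernel`. -/
def commConst (m : ℕ) : List (SchwartzMap E ℂ) → ℝ
  | [] => 1
  | f :: fs => ∫ ζ, ‖f ζ‖ * (2 * (1 + ‖ζ‖) ^ m * commConst m fs)

omit [InnerProductSpace ℝ E] [FiniteDimensional ℝ E] [MeasurableSpace E] [BorelSpace E] in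
lemma one_add_norm_add_pow_le (m : ℕ) (x y : E) :
    (1 + ‖x + y‖) ^ m ≤ (1 + ‖x‖) ^ m * (1 + ‖y‖) ^ m := by
  rw [← mul_pow]
  gcongr
  nlinarith [norm_add_le x y, norm_nonneg x, norm_nonneg y,
    mul_nonneg (norm_nonneg x) (norm_nonneg y)]

omit [InnerProductSpace ℝ E] [FiniteDimensional ℝ E] [MeasurableSpace E] [BorelSpace E] in
lemma one_le_one_add_norm_pow (m : ℕ) (x : E) : 1 ≤ (1 + ‖x‖) ^ m :=
  one_le_pow₀ (by linarith [norm_nonneg x])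

omit [InnerProductSpace ℝ E] [FiniteDimensional ℝ E] [BorelSpace E] in
lemma PolyBound.nonneg {m : ℕ} {B : ℝ} {p : E → ℂ} (h : PolyBound m B p) : 0 ≤ B := by
  have := (norm_nonneg _).trans (h.2 0)
  simpa using this

omit [InnerProductSpace ℝ E] [FiniteDimensional ℝ E] [BorelSpace E] in
lemma PolyDecay.nonneg {m : ℕ} {G : ℝ} {g : E → ℂ} (h : PolyDecay m G g) : 0 ≤ G := by
  have := h.2 0
  simp at this
  exact (norm_nonneg _).trans this

omit [InnerProductSpace ℝ E] [FiniteDimensional ℝ E] in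
lemma PolyBound.translate {m : ℕ} {B : ℝ} {p : E → ℂ} (h : PolyBound m B p) (ζ : E) :
    PolyBound m (B * (1 + ‖ζ‖) ^ m) (fun η => p (η + ζ)) := by
  refine ⟨h.1.comp (measurable_add_const ζ), fun x => (h.2 _).trans ?_⟩
  have := mul_le_mul_of_nonneg_left (one_add_norm_add_pow_le m x ζ) h.nonneg
  linarith

omit [InnerProductSpace ℝ E] [FiniteDimensional ℝ E] [BorelSpace E] in
lemma PolyBound.sub {m : ℕ} {B B' : ℝ} {p p' : E → ℂ} (h : PolyBound m B p)
    (h' : PolyBound m B' p') : PolyBound m (B + B') (fun η => p η - p' η) := by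
  refine ⟨h.1.sub h'.1, fun x => (norm_sub_le _ _).trans ?_⟩
  linarith [h.2 x, h'.2 x]

omit [InnerProductSpace ℝ E] [FiniteDimensional ℝ E] in
lemma PolyBound.diff {m : ℕ} {B : ℝ} {p : E → ℂ} (h : PolyBound m B p) (ζ : E) :
    PolyBound m (B * (2 * (1 + ‖ζ‖) ^ m)) (fun η => p η - p (η + ζ)) := by
  have h1 := h.sub (h.translate ζ)
  refine ⟨h1.1, fun x => (h1.2 x).trans ?_⟩
  have := one_le_one_add_norm_pow m ζ
  have := h.nonneg
  gcongr
  nlinarith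

omit [InnerProductSpace ℝ E] [FiniteDimensional ℝ E] in
lemma PolyDecay.translate {m : ℕ} {G : ℝ} {g : E → ℂ} (h : PolyDecay m G g) (ζ : E) :
    PolyDecay m (G * (1 + ‖ζ‖) ^ m) (fun η => g (η - ζ)) := by
  refine ⟨h.1.comp (measurable_sub_const ζ), fun x => ?_⟩
  have h1 := one_add_norm_add_pow_le m (x - ζ) ζ
  rw [sub_add_cancel] at h1
  calc ‖g (x - ζ)‖ * (1 + ‖x‖) ^ m
      ≤ ‖g (x - ζ)‖ * ((1 + ‖x - ζ‖) ^ m * (1 + ‖ζ‖) ^ m) := by gcongr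
    _ = (‖g (x - ζ)‖ * (1 + ‖x - ζ‖) ^ m) * (1 + ‖ζ‖) ^ m := by ring
    _ ≤ G * (1 + ‖ζ‖) ^ m := by gcongr; exact h.2 _

lemma integrable_norm_mul_one_add_norm_pow (f : SchwartzMap E ℂ) (m : ℕ) :
    Integrable fun ζ => ‖f ζ‖ * (1 + ‖ζ‖) ^ m := by
  have h : ∀ k ∈ Finset.range (m + 1), Integrable fun ζ : E =>
      (m.choose k : ℝ) * (‖ζ‖ ^ (m - k) * ‖f ζ‖) :=
    fun k _ => (f.integrable_pow_mul volume (m - k)).const_mul _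
  refine (integrable_finsetSum _ h).congr (.of_forall fun ζ => ?_)
  simp only [add_pow, one_pow, one_mul, Finset.mul_sum]
  refine Finset.sum_congr rfl fun k _ => by ring

omit [FiniteDimensional ℝ E] in
lemma exists_polyDecay (m : ℕ) (g : SchwartzMap E ℂ) : ∃ G, PolyDecay m G g := by
  refine ⟨2 ^ m * ((Finset.Iic (m, 0)).sup fun m => SchwartzMap.seminorm ℝ m.1 m.2) g,
    g.continuous.measurable, fun x => ?_⟩
  simpa [mul_comm] using
    SchwartzMap.one_add_le_sup_seminorm_apply (𝕜 := ℝ) (m := (m, 0)) le_rfl le_rfl g x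

lemma commConst_nonneg (m : ℕ) (fs : List (SchwartzMap E ℂ)) : 0 ≤ commConst m fs := by
  induction fs with
  | nil => simp [commConst]
  | cons f fs ih => exact integral_nonneg fun ζ => by positivity

lemma integrable_commConst (m : ℕ) (f : SchwartzMap E ℂ) (c : ℝ) :
    Integrable fun ζ => ‖f ζ‖ * (2 * (1 + ‖ζ‖) ^ m * c) := by
  refine ((integrable_norm_mul_one_add_norm_pow f m).const_mul (2 * c)).congr
    (.of_forall fun ζ => ?_)
  ring

lemma norm_commKernel_le {m : ℕ} (fs : List (SchwartzMap E ℂ)) {B G : ℝ} {p g : E → ℂ}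
    (hp : PolyBound m B p) (hg : PolyDecay m G g) (ξ : E) :
    ‖commKernel fs p g ξ‖ ≤ B * G * commConst m fs := by
  induction fs generalizing B p ξ with
  | nil =>
    simp only [commKernel, commConst, norm_mul, mul_one]
    have h0 := hp.nonneg
    calc ‖p ξ‖ * ‖g ξ‖ ≤ (B * (1 + ‖ξ‖) ^ m) * ‖g ξ‖ := by gcongr; exact hp.2 ξ
      _ = B * (‖g ξ‖ * (1 + ‖ξ‖) ^ m) := by ring
      _ ≤ B * G := by gcongr; exact hg.2 ξ
  | cons f fs ih =>
    simp only [commKernel, commConst]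
    rw [← integral_const_mul]
    refine norm_integral_le_of_norm_le ((integrable_commConst m f _).const_mul _)
      (.of_forall fun ζ => ?_)
    rw [norm_mul]
    calc ‖f ζ‖ * _ ≤ ‖f ζ‖ * (B * (2 * (1 + ‖ζ‖) ^ m) * G * commConst m fs) := by
          gcongr; exact ih (hp.diff ζ) _
      _ = _ := by ring

lemma measurable_commKernel (fs : List (SchwartzMap E ℂ)) {Θ : Type u} [MeasurableSpace Θ]
    {p g : Θ → E → ℂ} (hp : Measurable fun x : Θ × E => p x.1 x.2)
    (hg : Measurable fun x : Θ × E => g x.1 x.2) :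
    Measurable fun x : Θ × E => commKernel fs (p x.1) (g x.1) x.2 := by
  induction fs generalizing Θ with
  | nil => exact hp.mul hg
  | cons f fs ih =>
    have h := ih (Θ := Θ × E) (p := fun x η => p x.1 η - p x.1 (η + x.2)) (g := fun x => g x.1)
      (by
        refine Measurable.sub
          (hp.comp (by fun_prop : Measurable fun x : (Θ × E) × E => (x.1.1, x.2)))
          (hp.comp (by fun_prop : Measurable fun x : (Θ × E) × E => (x.1.1, x.2 + x.1.2))))
      (hg.comp (by fun_prop : Measurable fun x : (Θ × E) × E => (x.1.1, x.2)))
    have h2 : Measurable fun x : (Θ × E) × E =>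
        f x.2 * commKernel fs (fun η => p x.1.1 η - p x.1.1 (η + x.2)) (g x.1.1) (x.1.2 - x.2) := by
      refine (f.continuous.measurable.comp measurable_snd).mul ?_
      exact h.comp (by fun_prop : Measurable fun x : (Θ × E) × E => ((x.1.1, x.2), x.1.2 - x.2))
    exact h2.stronglyMeasurable.integral_prod_right.measurable

lemma measurable_commKernel_apply (fs : List (SchwartzMap E ℂ)) {p g : E → ℂ}
    (hp : Measurable p) (hg : Measurable g) : Measurable (commKernel fs p g) := by
  have h := measurable_commKernel fs (Θ := PUnit) (p := fun _ => p) (g := fun _ => g)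
    (hp.comp measurable_snd) (hg.comp measurable_snd)
  exact h.comp (measurable_prodMk_left (x := PUnit.unit))

lemma integrable_commKernel {m : ℕ} (f : SchwartzMap E ℂ) (fs : List (SchwartzMap E ℂ)) {B G : ℝ}
    {p g : E → ℂ} (hp : PolyBound m B p) (hg : PolyDecay m G g) (ξ : E) :
    Integrable fun ζ => f ζ * commKernel fs (fun η => p η - p (η + ζ)) g (ξ - ζ) := by
  refine ((integrable_commConst m f (B * G * commConst m fs))).mono' ?_ (.of_forall fun ζ => ?_)
  · refine (f.continuous.measurable.mul ?_).aestronglyMeasurable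
    have h := measurable_commKernel fs (Θ := E) (p := fun ζ η => p η - p (η + ζ)) (g := fun _ => g)
      ((hp.1.comp measurable_snd).sub (hp.1.comp (measurable_snd.add measurable_fst)))
      (hg.1.comp measurable_snd)
    exact h.comp (by fun_prop : Measurable fun ζ : E => (ζ, ξ - ζ))
  · rw [norm_mul]
    gcongr
    exact (norm_commKernel_le fs (hp.diff ζ) hg _).trans_eq (by ring)

lemma commKernel_sub {m : ℕ} (fs : List (SchwartzMap E ℂ)) {B B' G : ℝ} {p p' g : E → ℂ}
    (hp : PolyBound m B p) (hp' : PolyBound m B' p') (hg : PolyDecay m G g) (ξ : E) :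
    commKernel fs (fun η => p η - p' η) g ξ = commKernel fs p g ξ - commKernel fs p' g ξ := by
  induction fs generalizing B B' p p' ξ with
  | nil => simp only [commKernel]; ring
  | cons f fs ih =>
    simp only [commKernel]
    rw [← integral_sub (integrable_commKernel f fs hp hg ξ) (integrable_commKernel f fs hp' hg ξ)]
    congr 1 with ζ
    rw [← mul_sub, ← ih (hp.diff ζ) (hp'.diff ζ)]
    congr 3 with η
    ring

lemma commKernel_translate (fs : List (SchwartzMap E ℂ)) (p g : E → ℂ) (ζ ξ : E) :
    commKernel fs (fun η => p (η + ζ)) g (ξ - ζ) = commKernel fs p (fun η => g (η - ζ)) ξ := by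
  induction fs generalizing p ξ with
  | nil => simp [commKernel]
  | cons f fs ih =>
    simp only [commKernel]
    congr 1 with κ
    rw [← ih, sub_right_comm ξ ζ κ]
    simp only [add_right_comm]

lemma commKernel_convolution {m : ℕ} (fs : List (SchwartzMap E ℂ)) (f : SchwartzMap E ℂ) {B G : ℝ}
    {p g : E → ℂ} (hp : PolyBound m B p) (hg : PolyDecay m G g) (ξ : E) :
    commKernel fs p (fun η => ∫ ζ, f ζ * g (η - ζ)) ξ =
      ∫ ζ, f ζ * commKernel fs p (fun η => g (η - ζ)) ξ := by
  induction fs generalizing B p ξ with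
  | nil =>
    simp only [commKernel]
    rw [← integral_const_mul]
    congr 1 with ζ
    ring
  | cons h fs ih =>
    simp only [commKernel]
    simp_rw [ih (hp.diff _), ← integral_const_mul]
    rw [integral_integral_swap]
    · congr 1 with ζ
      congr 1 with κ
      ring
    refine ((((integrable_commConst m h (commConst m fs))).mul_prod
      (integrable_commConst m f (B * G)))).mono' ?_ (.of_forall fun x => ?_)
    · have h1 := measurable_commKernel fs (Θ := E × E) (p := fun x η => p η - p (η + x.1))
        (g := fun x η => g (η - x.2))
        (by exact (hp.1.comp measurable_snd).sub (hp.1.comp (by fun_prop)))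
        (hg.1.comp (by fun_prop))
      refine Measurable.aestronglyMeasurable ?_
      refine (h.continuous.measurable.comp measurable_fst).mul
        ((f.continuous.measurable.comp measurable_snd).mul ?_)
      exact h1.comp (by fun_prop : Measurable fun x : E × E => (x, ξ - x.1))
    · have h1 := norm_commKernel_le fs (hp.diff x.1) (hg.translate x.2) (ξ - x.1)
      have h2 := commConst_nonneg m fs
      have h3 := hp.nonneg
      have h4 := hg.nonneg
      simp only [Function.uncurry, norm_mul]
      calc ‖h x.1‖ * (‖f x.2‖ * _)
          ≤ ‖h x.1‖ * (‖f x.2‖ * (B * (2 * (1 + ‖x.1‖) ^ m) * (G * (1 + ‖x.2‖) ^ m) *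
              commConst m fs)) := by gcongr
        _ ≤ ‖h x.1‖ * (‖f x.2‖ * (B * (2 * (1 + ‖x.1‖) ^ m) * (G * (2 * (1 + ‖x.2‖) ^ m)) *
              commConst m fs)) := by
          have : 0 ≤ (1 + ‖x.2‖) ^ m := by positivity
          gcongr
          linarith
        _ = _ := by ring

/-- The recursion for `commKernel` as a commutator with the convolution by `f`. -/
lemma commKernel_cons {m : ℕ} (f : SchwartzMap E ℂ) (fs : List (SchwartzMap E ℂ)) {B G : ℝ}
    {p g : E → ℂ} (hp : PolyBound m B p) (hg : PolyDecay m G g) (ξ : E) :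
    commKernel (f :: fs) p g ξ = (∫ ζ, f ζ * commKernel fs p g (ξ - ζ)) -
      commKernel fs p (fun η => ∫ ζ, f ζ * g (η - ζ)) ξ := by
  rw [commKernel_convolution fs f hp hg, ← integral_sub]
  · simp only [commKernel, ← commKernel_translate, ← mul_sub]
    congr 1 with ζ
    rw [commKernel_sub fs hp (hp.translate ζ) hg]
  · refine ((integrable_commConst m f (B * G * commConst m fs))).mono' ?_ (.of_forall fun ζ => ?_)
    · refine (f.continuous.measurable.mul ?_).aestronglyMeasurable
      exact (measurable_commKernel_apply fs hp.1 hg.1).comp (measurable_const.sub measurable_id)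
    · rw [norm_mul]
      gcongr
      refine (norm_commKernel_le fs hp hg _).trans ?_
      have := one_le_one_add_norm_pow m ζ
      have h2 := commConst_nonneg m fs
      have h3 := hp.nonneg
      have h4 := hg.nonneg
      exact le_mul_of_one_le_left (by positivity) (by linarith)
  · refine ((integrable_commConst m f (B * G * commConst m fs))).mono' ?_ (.of_forall fun ζ => ?_)
    · refine (f.continuous.measurable.mul ?_).aestronglyMeasurable
      have h := measurable_commKernel fs (Θ := E) (p := fun _ => p) (g := fun ζ η => g (η - ζ))
        (hp.1.comp measurable_snd) (hg.1.comp (measurable_snd.sub measurable_fst))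
      exact h.comp (by fun_prop : Measurable fun ζ : E => (ζ, ξ))
    · rw [norm_mul]
      gcongr
      refine (norm_commKernel_le fs hp (hg.translate ζ) _).trans ?_
      have := one_le_one_add_norm_pow m ζ
      have h2 := commConst_nonneg m fs
      have h3 := hp.nonneg
      have h4 := hg.nonneg
      calc B * (G * (1 + ‖ζ‖) ^ m) * commConst m fs
          = (1 + ‖ζ‖) ^ m * (B * G * commConst m fs) := by ring
        _ ≤ _ := by gcongr; linarith

end Kernel

section Fourier

variable {d : ℕ}

lemma fourier_pairing_mul (f g : SchwartzMap (Ed d) ℂ) (ξ : Ed d) :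
    𝓕 (SchwartzMap.pairing (ContinuousLinearMap.mul ℂ ℂ) f g) ξ = ∫ ζ, 𝓕 f ζ * 𝓕 g (ξ - ζ) := by
  have h : SchwartzMap.pairing (ContinuousLinearMap.mul ℂ ℂ) f g =
      𝓕⁻ (SchwartzMap.convolution (ContinuousLinearMap.mul ℂ ℂ) (𝓕 f) (𝓕 g)) := by
    ext x
    rw [SchwartzMap.fourierInv_apply_eq, SchwartzMap.compCLMOfContinuousLinearEquiv_apply,
      Function.comp_apply, SchwartzMap.fourier_convolution, SchwartzMap.pairing_apply_apply,
      SchwartzMap.pairing_apply_apply]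
    have hf : f x = (𝓕⁻ (𝓕 f) : SchwartzMap (Ed d) ℂ) x := by
      rw [FourierTransform.fourierInv_fourier_eq]
    have hg : g x = (𝓕⁻ (𝓕 g) : SchwartzMap (Ed d) ℂ) x := by
      rw [FourierTransform.fourierInv_fourier_eq]
    rw [hf, hg, SchwartzMap.fourierInv_apply_eq, SchwartzMap.fourierInv_apply_eq]
    rfl
  rw [h, FourierTransform.fourier_fourierInv_eq, SchwartzMap.convolution_apply]
  rfl

lemma exists_schwartzMap_eq_iterComm {p : Ed d → ℂ} (hp : p.HasTemperateGrowth)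
    (fs : List (SchwartzMap (Ed d) ℂ)) (w : SchwartzMap (Ed d) ℂ) :
    ∃ S : SchwartzMap (Ed d) ℂ,
      iterComm (fm p) (fs.map (fun f : SchwartzMap (Ed d) ℂ => (f : Ed d → ℂ))) w = S ∧
      ∀ ξ, 𝓕 S ξ = commKernel (fs.map 𝓕) p (𝓕 w : SchwartzMap (Ed d) ℂ) ξ := by
  obtain ⟨m, B, hB⟩ := hp.2 0
  have hpB : PolyBound m B p := ⟨hp.1.continuous.measurable, by simpa using hB⟩
  induction fs generalizing w with
  | nil =>
    refine ⟨𝓕⁻ (SchwartzMap.smulLeftCLM ℂ p (𝓕 w)), ?_, fun ξ => ?_⟩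
    · rw [SchwartzMap.fourierInv_coe, SchwartzMap.smulLeftCLM_apply hp]
      rfl
    · rw [FourierTransform.fourier_fourierInv_eq, SchwartzMap.smulLeftCLM_apply_apply hp]
      rfl
  | cons f fs ih =>
    let M := SchwartzMap.pairing (ContinuousLinearMap.mul ℂ ℂ) (D := Ed d)
    obtain ⟨S, hS, hSF⟩ := ih w
    obtain ⟨S', hS', hSF'⟩ := ih (M f w)
    obtain ⟨G, hG⟩ := exists_polyDecay m (𝓕 w : SchwartzMap (Ed d) ℂ)
    refine ⟨M f S - S', ?_, fun ξ => ?_⟩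
    · ext x
      have h : (fun y => f y * w y) = ⇑(M f w) := by ext y; simp [M]
      simp only [List.map_cons, iterComm]
      rw [h, hS, hS']
      simp [M]
    · have h : ⇑(𝓕 (M f w) : SchwartzMap (Ed d) ℂ) =
          fun η => ∫ ζ, (𝓕 f : SchwartzMap (Ed d) ℂ) ζ * (𝓕 w : SchwartzMap (Ed d) ℂ) (η - ζ) := by
        ext η
        exact fourier_pairing_mul f w η
      rw [List.map_cons, commKernel_cons _ _ hpB hG, ← h, ← hSF',
        ← FourierTransform.fourierCLM_apply (R := ℂ), map_sub, sub_apply,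
        FourierTransform.fourierCLM_apply, FourierTransform.fourierCLM_apply, fourier_pairing_mul]
      simp_rw [hSF]

end Fourier

section Majorant

variable {E : Type u} [NormedAddCommGroup E] [InnerProductSpace ℝ E] [FiniteDimensional ℝ E]
  [MeasurableSpace E] [BorelSpace E]

open scoped ENNReal

lemma sq_lintegral_mul_le {α : Type*} [MeasurableSpace α] {μ : Measure α} {a b : α → ℝ≥0∞}
    (ha : Measurable a) (hb : Measurable b) :
    (∫⁻ x, a x * b x ∂μ) ^ 2 ≤ (∫⁻ x, a x ^ 2 ∂μ) * ∫⁻ x, b x ^ 2 ∂μ := by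
  have h := ENNReal.lintegral_mul_le_Lp_mul_Lq μ Real.HolderConjugate.two_two ha.aemeasurable
    hb.aemeasurable
  simp only [Pi.mul_apply, ENNReal.rpow_ofNat] at h
  calc _ ≤ _ := pow_le_pow_left' h 2
    _ = _ := by
      rw [mul_pow]
      simp only [← ENNReal.rpow_natCast, ← ENNReal.rpow_mul]
      norm_num

lemma lintegral_lintegral_convolution {a b : E → ℝ≥0∞} (ha : Measurable a) (hb : Measurable b) :
    ∫⁻ ξ, ∫⁻ ζ, a ζ * b (ξ - ζ) = (∫⁻ ζ, a ζ) * ∫⁻ ξ, b ξ := by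
  rw [lintegral_lintegral_swap (by fun_prop), ← lintegral_mul_const _ ha]
  congr 1 with ζ
  rw [lintegral_const_mul _ (by fun_prop), lintegral_sub_right_eq_self b]

lemma lintegral_sq_convolution_le {a b : E → ℝ≥0∞} (ha : Measurable a) (hb : Measurable b) :
    ∫⁻ ξ, (∫⁻ ζ, a ζ * b (ξ - ζ)) ^ 2 ≤ (∫⁻ ζ, a ζ) ^ 2 * ∫⁻ ξ, b ξ ^ 2 := by
  have key (ξ : E) : (∫⁻ ζ, a ζ * b (ξ - ζ)) ^ 2 ≤
      (∫⁻ ζ, a ζ) * ∫⁻ ζ, a ζ * b (ξ - ζ) ^ 2 := by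
    have hs (x : ℝ≥0∞) : (x ^ (1 / 2 : ℝ)) ^ 2 = x := by
      rw [← ENNReal.rpow_natCast, ← ENNReal.rpow_mul]
      norm_num
    have h := sq_lintegral_mul_le (μ := volume) (a := fun ζ => a ζ ^ (1 / 2 : ℝ))
      (b := fun ζ => a ζ ^ (1 / 2 : ℝ) * b (ξ - ζ)) (by fun_prop) (by fun_prop)
    simpa only [← mul_assoc, ← sq, mul_pow, hs] using h
  calc _ ≤ ∫⁻ ξ, (∫⁻ ζ, a ζ) * ∫⁻ ζ, a ζ * b (ξ - ζ) ^ 2 := lintegral_mono key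
    _ = (∫⁻ ζ, a ζ) * ∫⁻ ξ, ∫⁻ ζ, a ζ * (fun x => b x ^ 2) (ξ - ζ) :=
      lintegral_const_mul _ (Measurable.lintegral_prod_right (by fun_prop))
    _ = _ := by rw [lintegral_lintegral_convolution ha (hb.pow_const 2), sq, mul_assoc]

lemma lintegral_sq_convolution_le' {a b : E → ℝ≥0∞} (ha : Measurable a) (hb : Measurable b) :
    ∫⁻ ξ, (∫⁻ ζ, a ζ * b (ξ - ζ)) ^ 2 ≤ (∫⁻ ζ, a ζ ^ 2) * (∫⁻ ξ, b ξ) ^ 2 := by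
  have h (ξ : E) : ∫⁻ ζ, a ζ * b (ξ - ζ) = ∫⁻ ζ, b ζ * a (ξ - ζ) := by
    rw [← lintegral_sub_left_eq_self _ ξ]
    simp [mul_comm]
  simp_rw [h]
  rw [mul_comm]
  exact lintegral_sq_convolution_le hb ha

/-- The iterated convolution of the functions `v * |fᵢ|` and `|g|`. -/
def convMajorant (v : E → ℝ≥0∞) : List (SchwartzMap E ℂ) → (E → ℂ) → E → ℝ≥0∞
  | [], g, ξ => ‖g ξ‖ₑ
  | f :: fs, g, ξ => ∫⁻ ζ, v ζ * ‖f ζ‖ₑ * convMajorant v fs g (ξ - ζ)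

/-- The sum of all iterated convolutions of the functions `v * |fᵢ|` and `|g|` in which exactly
one of the factors carries the additional weight `V`. -/
def weightedMajorant (v V : E → ℝ≥0∞) : List (SchwartzMap E ℂ) → (E → ℂ) → E → ℝ≥0∞
  | [], g, ξ => V ξ * ‖g ξ‖ₑ
  | f :: fs, g, ξ => (∫⁻ ζ, V ζ * (v ζ * ‖f ζ‖ₑ) * convMajorant v fs g (ξ - ζ)) +
      ∫⁻ ζ, v ζ * ‖f ζ‖ₑ * weightedMajorant v V fs g (ξ - ζ)

lemma measurable_convMajorant {v : E → ℝ≥0∞} (hv : Measurable v) (fs : List (SchwartzMap E ℂ))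
    {g : E → ℂ} (hg : Measurable g) : Measurable (convMajorant v fs g) := by
  induction fs with
  | nil => exact hg.enorm
  | cons f fs ih =>
    have := f.continuous.measurable
    exact Measurable.lintegral_prod_right (by fun_prop)

lemma measurable_weightedMajorant {v V : E → ℝ≥0∞} (hv : Measurable v) (hV : Measurable V)
    (fs : List (SchwartzMap E ℂ)) {g : E → ℂ} (hg : Measurable g) :
    Measurable (weightedMajorant v V fs g) := by
  induction fs with
  | nil => exact hV.mul hg.enorm
  | cons f fs ih =>
    have := f.continuous.measurable
    have := measurable_convMajorant hv fs hg
    exact (Measurable.lintegral_prod_right (by fun_prop)).add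
      (Measurable.lintegral_prod_right (by fun_prop))

/-- Iterated differences of `p` in the directions of a list. -/
def iterDiff : List E → (E → ℂ) → E → ℂ
  | [], p => p
  | ζ :: zs, p => iterDiff zs (fun η => p η - p (η + ζ))

lemma mul_enorm_commKernel_le {v V : E → ℝ≥0∞} (hv : Measurable v) (hV : Measurable V)
    (fs : List (SchwartzMap E ℂ)) {g : E → ℂ} (hg : Measurable g) {p : E → ℂ} {ω : E → ℝ≥0∞}
    {A B : ℝ≥0∞}
    (h : ∀ zs : List E, zs.length = fs.length → ∀ η, ω (η + zs.sum) * ‖iterDiff zs p η‖ₑ ≤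
      B * (zs.map v).prod * (A + (zs.map V).sum + V η)) (ξ : E) :
    ω ξ * ‖commKernel fs p g ξ‖ₑ ≤
      B * (A * convMajorant v fs g ξ + weightedMajorant v V fs g ξ) := by
  induction fs generalizing p ω A B ξ with
  | nil =>
    have := h [] rfl ξ
    simp only [List.sum_nil, add_zero, iterDiff, List.map_nil, List.prod_nil, mul_one] at this
    simp only [commKernel, convMajorant, weightedMajorant, enorm_mul]
    calc _ = ω ξ * ‖p ξ‖ₑ * ‖g ξ‖ₑ := by ring
      _ ≤ B * (A + V ξ) * ‖g ξ‖ₑ := by gcongr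
      _ = _ := by ring
  | cons f fs ih =>
    have hf := f.continuous.measurable
    have h1 := measurable_convMajorant hv fs hg
    have h2 := measurable_weightedMajorant hv hV fs hg
    have key (ζ : E) : ω ξ * ‖commKernel fs (fun η => p η - p (η + ζ)) g (ξ - ζ)‖ₑ ≤
        B * v ζ * ((A + V ζ) * convMajorant v fs g (ξ - ζ) +
          weightedMajorant v V fs g (ξ - ζ)) := by
      have := ih (p := fun η => p η - p (η + ζ)) (ω := fun x => ω (x + ζ)) (A := A + V ζ)
        (B := B * v ζ) (fun zs hzs η => ?_) (ξ - ζ)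
      · simpa using this
      · have := h (ζ :: zs) (by simp [hzs]) η
        simp only [List.sum_cons, List.map_cons, List.prod_cons, iterDiff] at this
        rw [add_assoc, add_comm zs.sum, mul_assoc B, add_assoc A]
        exact this
    simp only [commKernel, convMajorant, weightedMajorant]
    calc ω ξ * ‖∫ ζ, f ζ * commKernel fs (fun η => p η - p (η + ζ)) g (ξ - ζ)‖ₑ
        ≤ ω ξ * ∫⁻ ζ, ‖f ζ * commKernel fs (fun η => p η - p (η + ζ)) g (ξ - ζ)‖ₑ := by
          gcongr
          exact enorm_integral_le_lintegral_enorm _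
      _ ≤ ∫⁻ ζ, ω ξ * ‖f ζ * commKernel fs (fun η => p η - p (η + ζ)) g (ξ - ζ)‖ₑ :=
          lintegral_const_mul_le _ _
      _ ≤ ∫⁻ ζ, B * (A * (v ζ * ‖f ζ‖ₑ * convMajorant v fs g (ξ - ζ)) +
            (V ζ * (v ζ * ‖f ζ‖ₑ) * convMajorant v fs g (ξ - ζ) +
              v ζ * ‖f ζ‖ₑ * weightedMajorant v V fs g (ξ - ζ))) := by
          refine lintegral_mono fun ζ => ?_
          dsimp only
          rw [enorm_mul, mul_left_comm]
          calc _ ≤ _ := mul_le_mul_right (key ζ) _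
            _ = _ := by ring
      _ = _ := by
          rw [lintegral_const_mul _ (by fun_prop), lintegral_add_left (by fun_prop),
            lintegral_const_mul _ (by fun_prop), lintegral_add_left (by fun_prop)]

lemma sq_lintegral_convMajorant_le {v V : E → ℝ≥0∞} (hv : Measurable v)
    {c : ℝ≥0∞} (hc : ∀ u : E → ℝ≥0∞, Measurable u → (∫⁻ x, u x) ^ 2 ≤ c * ∫⁻ x, (V x * u x) ^ 2)
    (fs : List (SchwartzMap E ℂ)) {g : E → ℂ} (hg : Measurable g) :
    (∫⁻ ξ, convMajorant v fs g ξ) ^ 2 ≤ c ^ (fs.length + 1) *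
      ((fs.map fun f => ∫⁻ x, (V x * (v x * ‖f x‖ₑ)) ^ 2).prod * ∫⁻ x, (V x * ‖g x‖ₑ) ^ 2) := by
  induction fs with
  | nil => simpa [convMajorant] using hc _ hg.enorm
  | cons f fs ih =>
    have hf := f.continuous.measurable
    have h1 := measurable_convMajorant hv fs hg
    simp only [convMajorant]
    rw [lintegral_lintegral_convolution (by fun_prop) h1, mul_pow]
    calc _ ≤ _ := mul_le_mul' (hc (fun x => v x * ‖f x‖ₑ) (hv.mul hf.enorm)) ih
      _ = _ := by
        simp only [List.map_cons, List.prod_cons, List.length_cons]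
        ring

lemma exists_lintegral_sq_weightedMajorant_le {v V : E → ℝ≥0∞} (hv : Measurable v)
    (hV : Measurable V) {c : ℝ≥0∞} (hc' : c ≠ ∞)
    (hc : ∀ u : E → ℝ≥0∞, Measurable u → (∫⁻ x, u x) ^ 2 ≤ c * ∫⁻ x, (V x * u x) ^ 2) (n : ℕ) :
    ∃ C ≠ ∞, ∀ fs : List (SchwartzMap E ℂ), fs.length = n → ∀ g : E → ℂ, Measurable g →
      ∫⁻ ξ, weightedMajorant v V fs g ξ ^ 2 ≤ C *
        ((fs.map fun f => ∫⁻ x, (V x * (v x * ‖f x‖ₑ)) ^ 2).prod *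
          ∫⁻ x, (V x * ‖g x‖ₑ) ^ 2) := by
  induction n with
  | zero =>
    refine ⟨1, by simp, fun fs hfs g hg => ?_⟩
    rw [List.length_eq_zero_iff] at hfs
    simp [hfs, weightedMajorant]
  | succ n ih =>
    obtain ⟨C, hC, h⟩ := ih
    refine ⟨2 * (c ^ (n + 1) + c * C), by finiteness, fun fs hfs g hg => ?_⟩
    obtain ⟨f, fs, rfl⟩ := List.exists_cons_of_length_eq_add_one hfs
    have hn : fs.length = n := by simpa using hfs
    have hf := f.continuous.measurable
    have h1 := measurable_convMajorant hv fs hg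
    have h2 := measurable_weightedMajorant hv hV fs hg
    set P := (fs.map fun f => ∫⁻ x, (V x * (v x * ‖f x‖ₑ)) ^ 2).prod * ∫⁻ x, (V x * ‖g x‖ₑ) ^ 2
      with hP
    set X := ∫⁻ x, (V x * (v x * ‖f x‖ₑ)) ^ 2 with hX
    have e1 : ∫⁻ ξ, (∫⁻ ζ, V ζ * (v ζ * ‖f ζ‖ₑ) * convMajorant v fs g (ξ - ζ)) ^ 2 ≤
        X * (c ^ (n + 1) * P) := by
      refine (lintegral_sq_convolution_le' (by fun_prop) h1).trans ?_
      gcongr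
      exact hn ▸ sq_lintegral_convMajorant_le hv hc fs hg
    have e2 : ∫⁻ ξ, (∫⁻ ζ, v ζ * ‖f ζ‖ₑ * weightedMajorant v V fs g (ξ - ζ)) ^ 2 ≤
        (c * X) * (C * P) := by
      refine (lintegral_sq_convolution_le (by fun_prop) h2).trans ?_
      gcongr
      · exact hc _ (by fun_prop)
      · exact h fs hn g hg
    have add_sq_le (a b : ℝ≥0∞) : (a + b) ^ 2 ≤ 2 * (a ^ 2 + b ^ 2) := by
      have := ENNReal.rpow_add_le_mul_rpow_add_rpow a b (p := 2) (by norm_num)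
      norm_num at this
      exact this
    simp only [weightedMajorant]
    calc _ ≤ ∫⁻ ξ, 2 * ((∫⁻ ζ, V ζ * (v ζ * ‖f ζ‖ₑ) * convMajorant v fs g (ξ - ζ)) ^ 2 +
          (∫⁻ ζ, v ζ * ‖f ζ‖ₑ * weightedMajorant v V fs g (ξ - ζ)) ^ 2) :=
          lintegral_mono fun ξ => add_sq_le _ _
      _ ≤ 2 * (X * (c ^ (n + 1) * P) + (c * X) * (C * P)) := by
          have m1 : Measurable fun ξ => ∫⁻ ζ, V ζ * (v ζ * ‖f ζ‖ₑ) * convMajorant v fs g (ξ - ζ) :=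
            Measurable.lintegral_prod_right (by fun_prop)
          rw [lintegral_const_mul' _ _ (by simp), lintegral_add_left (m1.pow_const 2)]
          gcongr
      _ = _ := by
          simp only [List.map_cons, List.prod_cons]
          rw [mul_assoc X, ← hP]
          ring

end Majorant

section Weights

variable {E : Type u} [NormedAddCommGroup E]

open scoped ENNReal

/-- The weight `(1 + ‖x‖²) ^ (s / 2)` with values in `ℝ≥0∞`. -/
def japaneseWeight (s : ℝ) (x : E) : ℝ≥0∞ :=
  ENNReal.ofReal ((1 + ‖x‖ ^ 2) ^ (s / 2))

lemma measurable_japaneseWeight [MeasurableSpace E] [BorelSpace E] (s : ℝ) :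
    Measurable (japaneseWeight (E := E) s) := by
  unfold japaneseWeight
  fun_prop

lemma japaneseWeight_mul (s t : ℝ) (x : E) :
    japaneseWeight s x * japaneseWeight t x = japaneseWeight (s + t) x := by
  rw [japaneseWeight, japaneseWeight, japaneseWeight, ← ENNReal.ofReal_mul (by positivity),
    ← Real.rpow_add (by positivity), add_div]

lemma japaneseWeight_mul_neg (s : ℝ) (x : E) : japaneseWeight (-s) x * japaneseWeight s x = 1 := by
  rw [japaneseWeight_mul]
  simp [japaneseWeight]

lemma sq_japaneseWeight_mul_enorm (s : ℝ) (x : E) (z : ℂ) :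
    (japaneseWeight s x * ‖z‖ₑ) ^ 2 = ENNReal.ofReal ((1 + ‖x‖ ^ 2) ^ s * ‖z‖ ^ 2) := by
  rw [japaneseWeight, ← ofReal_norm, ← ENNReal.ofReal_mul (by positivity),
    ← ENNReal.ofReal_pow (by positivity), mul_pow, ← Real.rpow_natCast (_ ^ (s / 2)),
    ← Real.rpow_mul (by positivity)]
  norm_num

lemma one_add_add_sq_rpow_le {s : ℝ} (hs : 0 ≤ s) {a b : ℝ} (ha : 0 ≤ a) (hb : 0 ≤ b) :
    (1 + (a + b) ^ 2) ^ (s / 2) ≤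
      4 ^ (s / 2) * ((1 + a ^ 2) ^ (s / 2) + (1 + b ^ 2) ^ (s / 2)) := by
  have key {a b : ℝ} (ha : 0 ≤ a) (hab : a ≤ b) :
      (1 + (a + b) ^ 2) ^ (s / 2) ≤ 4 ^ (s / 2) * (1 + b ^ 2) ^ (s / 2) := by
    rw [← Real.mul_rpow (by norm_num) (by positivity)]
    gcongr
    nlinarith
  rw [mul_add]
  rcases le_total a b with h | h
  · exact (key ha h).trans (le_add_of_nonneg_left (by positivity))
  · rw [add_comm a b]
    exact (key hb h).trans (le_add_of_nonneg_right (by positivity))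

lemma ofReal_one_add_sum_sq_rpow_le {s : ℝ} (hs : 0 ≤ s) (zs : List E) (η : E) :
    ENNReal.ofReal ((1 + (‖η‖ + (zs.map norm).sum) ^ 2) ^ (s / 2)) ≤
      ENNReal.ofReal (4 ^ (s / 2)) ^ zs.length *
        ((zs.map (japaneseWeight s)).sum + japaneseWeight s η) := by
  induction zs with
  | nil => simp [japaneseWeight]
  | cons ζ zs ih =>
    have h0 : 0 ≤ (zs.map norm).sum := List.sum_nonneg (by simp)
    have h1 : 1 ≤ ENNReal.ofReal (4 ^ (s / 2)) := by
      rw [ENNReal.one_le_ofReal]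
      exact Real.one_le_rpow (by norm_num) (by positivity)
    simp only [List.map_cons, List.sum_cons, List.length_cons]
    rw [show ‖η‖ + (‖ζ‖ + (zs.map norm).sum) = ‖ζ‖ + (‖η‖ + (zs.map norm).sum) by ring]
    calc _ ≤ ENNReal.ofReal (4 ^ (s / 2) * ((1 + ‖ζ‖ ^ 2) ^ (s / 2) +
          (1 + (‖η‖ + (zs.map norm).sum) ^ 2) ^ (s / 2))) :=
          ENNReal.ofReal_le_ofReal (one_add_add_sq_rpow_le hs (by positivity) (by positivity))
      _ = ENNReal.ofReal (4 ^ (s / 2)) * (japaneseWeight s ζ +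
          ENNReal.ofReal ((1 + (‖η‖ + (zs.map norm).sum) ^ 2) ^ (s / 2))) := by
          rw [ENNReal.ofReal_mul (by positivity),
            ENNReal.ofReal_add (by positivity) (by positivity)]
          rfl
      _ ≤ ENNReal.ofReal (4 ^ (s / 2)) * (ENNReal.ofReal (4 ^ (s / 2)) ^ zs.length *
          japaneseWeight s ζ + ENNReal.ofReal (4 ^ (s / 2)) ^ zs.length *
            ((zs.map (japaneseWeight s)).sum + japaneseWeight s η)) := by
          gcongr
          exact le_mul_of_one_le_left zero_le (one_le_pow₀ h1)
      _ = _ := by ring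

lemma ofReal_prod_norm_le (zs : List E) :
    ENNReal.ofReal (zs.map norm).prod ≤ (zs.map (japaneseWeight 1)).prod := by
  induction zs with
  | nil => simp
  | cons ζ zs ih =>
    simp only [List.map_cons, List.prod_cons]
    rw [ENNReal.ofReal_mul (norm_nonneg _)]
    gcongr
    refine ENNReal.ofReal_le_ofReal ?_
    rw [← Real.sqrt_eq_rpow]
    exact Real.le_sqrt_of_sq_le (by linarith)

lemma norm_add_sum_le (η : E) (zs : List E) : ‖η + zs.sum‖ ≤ ‖η‖ + (zs.map norm).sum := by
  induction zs generalizing η with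
  | nil => simp
  | cons ζ zs ih =>
    simp only [List.map_cons, List.sum_cons]
    rw [← add_assoc]
    linarith [ih (η + ζ), norm_add_le η ζ]

variable [InnerProductSpace ℝ E]

lemma norm_iterDiff_le (zs : List E) {p : E → ℂ} (hp : ContDiff ℝ (⊤ : ℕ∞) p) {M R : ℝ} {η : E}
    (hM : ∀ x, ‖x‖ ≤ R → ‖iteratedFDeriv ℝ zs.length p x‖ ≤ M)
    (hR : ‖η‖ + (zs.map norm).sum ≤ R) :
    ‖iterDiff zs p η‖ ≤ (zs.map norm).prod * M := by
  induction zs generalizing p M R with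
  | nil => simpa [iterDiff] using hM η (by simpa using hR)
  | cons ζ zs ih =>
    simp only [List.map_cons, List.sum_cons, List.prod_cons, List.length_cons] at *
    have hp' : ContDiff ℝ (⊤ : ℕ∞) fun η => p (η + ζ) := hp.comp (contDiff_id.add contDiff_const)
    have := ih (p := fun η => p η - p (η + ζ)) (hp.sub hp') (M := ‖ζ‖ * M) (R := R - ‖ζ‖)
      (fun x hx => ?_) (by linarith)
    · rw [iterDiff]
      exact this.trans_eq (by ring)
    · have hle : ((zs.length : ℕ∞) : WithTop ℕ∞) ≤ ((⊤ : ℕ∞) : WithTop ℕ∞) := mod_cast le_top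
      rw [fun_iteratedFDeriv_sub_apply (hp.of_le hle).contDiffAt (hp'.of_le hle).contDiffAt,
        iteratedFDeriv_comp_add_right, norm_sub_rev]
      have h := (convex_closedBall (0 : E) R).norm_image_sub_le_of_norm_fderiv_le
        (f := iteratedFDeriv ℝ zs.length p) (𝕜 := ℝ) (C := M) (x := x) (y := x + ζ)
        (fun y _ =>
          (hp.differentiable_iteratedFDeriv (mod_cast ENat.natCast_lt_top _)).differentiableAt)
        (fun y hy => ?_) ?_ ?_
      · rw [add_sub_cancel_left] at h
        linarith
      · rw [norm_fderiv_iteratedFDeriv]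
        exact hM y (by simpa using hy)
      · simp
        linarith [norm_nonneg ζ]
      · simp
        linarith [norm_add_le x ζ]

lemma japaneseWeight_mul_enorm_iterDiff_le {n : ℕ} {q r C : ℝ} (hr1 : 1 ≤ r) (hrq : r ≤ q)
    {p : E → ℂ} (hp : ContDiff ℝ (⊤ : ℕ∞) p)
    (hC : ∀ ξ, ‖iteratedFDeriv ℝ n p ξ‖ ≤ C * (1 + ‖ξ‖ ^ 2) ^ ((r - 1) / 2))
    (hC0 : 0 < C) (zs : List E) (hzs : zs.length = n) (η : E) :
    japaneseWeight (q - r) (η + zs.sum) * ‖iterDiff zs p η‖ₑ ≤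
      ENNReal.ofReal C * ENNReal.ofReal (4 ^ ((q - 1) / 2)) ^ n * (zs.map (japaneseWeight 1)).prod *
        (0 + (zs.map (japaneseWeight (q - 1))).sum + japaneseWeight (q - 1) η) := by
  have h0 : 0 ≤ (zs.map norm).sum := List.sum_nonneg (by simp)
  have h0' : 0 ≤ (zs.map norm).prod := List.prod_nonneg (by simp)
  set R := ‖η‖ + (zs.map norm).sum with hR
  have hb : ‖iterDiff zs p η‖ ≤ (zs.map norm).prod * (C * (1 + R ^ 2) ^ ((r - 1) / 2)) := by
    refine norm_iterDiff_le zs hp (R := R) (fun x hx => ?_) le_rfl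
    rw [hzs]
    refine (hC x).trans ?_
    have : 0 ≤ (r - 1) / 2 := by linarith
    gcongr
  have hw : japaneseWeight (q - r) (η + zs.sum) ≤ ENNReal.ofReal ((1 + R ^ 2) ^ ((q - r) / 2)) := by
    refine ENNReal.ofReal_le_ofReal ?_
    have : 0 ≤ (q - r) / 2 := by linarith
    have := norm_add_sum_le η zs
    gcongr
  calc _ ≤ ENNReal.ofReal ((1 + R ^ 2) ^ ((q - r) / 2)) *
        ENNReal.ofReal ((zs.map norm).prod * (C * (1 + R ^ 2) ^ ((r - 1) / 2))) := by
        gcongr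
        rw [← ofReal_norm]
        exact ENNReal.ofReal_le_ofReal hb
    _ = ENNReal.ofReal (zs.map norm).prod * ENNReal.ofReal C *
          ENNReal.ofReal ((1 + R ^ 2) ^ ((q - 1) / 2)) := by
        rw [← ENNReal.ofReal_mul (by positivity), ← ENNReal.ofReal_mul (by positivity),
          ← ENNReal.ofReal_mul (by positivity),
          show (q - 1) / 2 = (q - r) / 2 + (r - 1) / 2 by ring, Real.rpow_add (by positivity)]
        congr 1
        ring
    _ ≤ (zs.map (japaneseWeight 1)).prod * ENNReal.ofReal C *
          (ENNReal.ofReal (4 ^ ((q - 1) / 2)) ^ zs.length *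
            ((zs.map (japaneseWeight (q - 1))).sum + japaneseWeight (q - 1) η)) := by
        gcongr
        · exact ofReal_prod_norm_le zs
        · exact ofReal_one_add_sum_sq_rpow_le (by linarith) zs η
    _ = _ := by rw [hzs, zero_add]; ring

variable [FiniteDimensional ℝ E] [MeasurableSpace E] [BorelSpace E]

lemma exists_sq_lintegral_le_japaneseWeight {s : ℝ} (hs : (Module.finrank ℝ E : ℝ) < 2 * s) :
    ∃ c ≠ ∞, ∀ u : E → ℝ≥0∞, Measurable u →
      (∫⁻ x, u x) ^ 2 ≤ c * ∫⁻ x, (japaneseWeight s x * u x) ^ 2 := by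
  refine ⟨∫⁻ x : E, japaneseWeight (-s) x ^ 2, ?_, fun u hu => ?_⟩
  · refine ne_of_lt ?_
    convert (integrable_rpow_neg_one_add_norm_sq (E := E) (μ := volume) hs).lintegral_lt_top using 3
      with x
    have := sq_japaneseWeight_mul_enorm (-s) x 1
    simp only [enorm_one, mul_one, norm_one, one_pow] at this
    rw [this]
    ring_nf
  · have h := sq_lintegral_mul_le (μ := volume) (measurable_japaneseWeight (E := E) (-s))
      ((measurable_japaneseWeight s).mul hu)
    simpa only [Pi.mul_apply, ← mul_assoc, japaneseWeight_mul_neg, one_mul] using h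

end Weights

section Main

variable {d : ℕ}

open scoped ENNReal

lemma IsSymbolS.hasTemperateGrowth_s5 {r : ℝ} {p : Ed d → ℂ} (hp : IsSymbolS r p) :
    p.HasTemperateGrowth := by
  refine ⟨hp.1, fun n => ?_⟩
  obtain ⟨C, hC, h⟩ := hp.2 n
  refine ⟨⌈|r - n|⌉₊, C, fun x => (h x).trans ?_⟩
  have hx := norm_nonneg x
  gcongr
  calc (1 + ‖x‖ ^ 2) ^ ((r - n) / 2) ≤ (1 + ‖x‖ ^ 2) ^ (|r - n| / 2) := by
        gcongr
        · nlinarith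
        · exact le_abs_self _
    _ ≤ ((1 + ‖x‖) ^ 2) ^ (|r - n| / 2) := by
        gcongr
        nlinarith
    _ = (1 + ‖x‖) ^ |r - n| := by
        rw [← Real.rpow_natCast, ← Real.rpow_mul (by positivity)]
        congr 1
        push_cast
        ring
    _ ≤ (1 + ‖x‖) ^ (⌈|r - n|⌉₊ : ℝ) := by
        gcongr
        · linarith
        · exact Nat.le_ceil _
    _ = _ := Real.rpow_natCast _ _

lemma HNorm_nonneg (s : ℝ) (f : Ed d → ℂ) : 0 ≤ HNorm s f :=
  Real.rpow_nonneg (integral_nonneg fun ξ => by positivity) _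

lemma ofReal_HNorm_sq (s : ℝ) (f : SchwartzMap (Ed d) ℂ) :
    ENNReal.ofReal (HNorm s f ^ 2) =
      ∫⁻ ξ, (japaneseWeight s ξ * ‖(𝓕 f : SchwartzMap (Ed d) ℂ) ξ‖ₑ) ^ 2 := by
  have hsq : HNorm s f ^ 2 = ∫ ξ : Ed d, (1 + ‖ξ‖ ^ 2) ^ s * ‖𝓕 (f : Ed d → ℂ) ξ‖ ^ 2 := by
    rw [HNorm, ← Real.rpow_natCast,
      ← Real.rpow_mul (integral_nonneg fun ξ => by positivity)]
    norm_num
  have hint : Integrable fun ξ : Ed d => (1 + ‖ξ‖ ^ 2) ^ s * ‖𝓕 (f : Ed d → ℂ) ξ‖ ^ 2 := by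
    have hw := Function.hasTemperateGrowth_one_add_norm_sq_rpow (Ed d) s
    refine (SchwartzMap.pairing (ContinuousLinearMap.mul ℂ ℂ)
      (SchwartzMap.smulLeftCLM ℂ (fun x : Ed d => (1 + ‖x‖ ^ 2) ^ s) (𝓕 f))
      (𝓕 f)).integrable.norm.congr
      (.of_forall fun ξ => ?_)
    beta_reduce
    rw [SchwartzMap.pairing_apply_apply, SchwartzMap.smulLeftCLM_apply_apply hw]
    simp only [ContinuousLinearMap.mul_apply', norm_mul, norm_smul]
    rw [Real.norm_of_nonneg (by positivity), mul_assoc, ← sq]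
    rfl
  rw [hsq, ofReal_integral_eq_lintegral_ofReal hint (.of_forall fun ξ => by positivity)]
  simp_rw [sq_japaneseWeight_mul_enorm]
  rfl

end Main

/-- Multilinear commutator estimate: for a symbol `p` of class `S^{r+n-1}`,
`‖[f₁,[…[fₙ, p(D)]…]]w‖_{H^{q-r}} ≤ C ‖f₁‖_{H^q} ⋯ ‖fₙ‖_{H^q} ‖w‖_{H^{q-1}}`. -/
theorem iterated_commutator_estimate (d : ℕ) (hd : 1 ≤ d) (n : ℕ) (hn : 1 ≤ n)
    (q r : ℝ) (hq : 1 + (d : ℝ) / 2 < q) (hr1 : 1 ≤ r) (hrq : r ≤ q)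
    (p : Ed d → ℂ) (hp : IsSymbolS (r + n - 1) p) :
    ∃ C > 0, ∀ (f : Fin n → SchwartzMap (Ed d) ℂ) (w : SchwartzMap (Ed d) ℂ),
      HNorm (q - r) (iterComm (fm p) (List.ofFn (fun i => ⇑(f i))) ⇑w)
        ≤ C * (∏ i, HNorm q ⇑(f i)) * HNorm (q - 1) ⇑w := by
  obtain ⟨C₀, hC₀, hsymb⟩ := hp.2 n
  simp only [show r + n - 1 - n = r - 1 by ring] at hsymb
  obtain ⟨c, hc', hc⟩ := exists_sq_lintegral_le_japaneseWeight (E := Ed d) (s := q - 1)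
    (by rw [finrank_euclideanSpace_fin]; linarith)
  have hv := measurable_japaneseWeight (E := Ed d) 1
  have hV := measurable_japaneseWeight (E := Ed d) (q - 1)
  obtain ⟨C₁, hC₁, hL2⟩ := exists_lintegral_sq_weightedMajorant_le hv hV hc' hc n
  set B := ENNReal.ofReal C₀ * ENNReal.ofReal (4 ^ ((q - 1) / 2)) ^ n with hB
  set K := (B ^ 2 * C₁).toReal with hK
  have hKtop : B ^ 2 * C₁ ≠ ⊤ := by finiteness
  refine ⟨√K + 1, by positivity, fun f w => ?_⟩
  obtain ⟨S, hS, hSF⟩ := exists_schwartzMap_eq_iterComm hp.hasTemperateGrowth_s5 (List.ofFn f) w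
  rw [List.map_ofFn] at hS
  have hS' : iterComm (fm p) (List.ofFn (fun i => ⇑(f i))) ⇑w = S := hS
  rw [hS']
  set fs := (List.ofFn f).map 𝓕 with hfs
  have hlen : fs.length = n := by simp [hfs]
  have hgm : Measurable (𝓕 w : SchwartzMap (Ed d) ℂ) :=
    (𝓕 w : SchwartzMap (Ed d) ℂ).continuous.measurable
  have hprod : (fs.map fun f =>
      ∫⁻ x, (japaneseWeight (q - 1) x * (japaneseWeight 1 x * ‖f x‖ₑ)) ^ 2).prod =
        ENNReal.ofReal ((∏ i, HNorm q (f i)) ^ 2) := by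
    rw [← Finset.prod_pow, ENNReal.ofReal_prod_of_nonneg fun i _ => sq_nonneg _, hfs, List.map_map,
      List.map_ofFn, List.prod_ofFn]
    refine Finset.prod_congr rfl fun i _ => ?_
    rw [ofReal_HNorm_sq]
    simp only [Function.comp_apply, ← mul_assoc, japaneseWeight_mul, sub_add_cancel]
  have hmain : ENNReal.ofReal (HNorm (q - r) S ^ 2) ≤
      ENNReal.ofReal (K * ((∏ i, HNorm q (f i)) * HNorm (q - 1) w) ^ 2) := by
    calc _ = ∫⁻ ξ, (japaneseWeight (q - r) ξ *
            ‖commKernel fs p (𝓕 w : SchwartzMap (Ed d) ℂ) ξ‖ₑ) ^ 2 := by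
          rw [ofReal_HNorm_sq]
          simp_rw [hSF]
      _ ≤ ∫⁻ ξ, B ^ 2 * weightedMajorant (japaneseWeight 1) (japaneseWeight (q - 1)) fs
            (𝓕 w : SchwartzMap (Ed d) ℂ) ξ ^ 2 := by
          refine lintegral_mono fun ξ => ?_
          have := mul_enorm_commKernel_le hv hV fs hgm (p := p)
            (ω := japaneseWeight (q - r)) (A := 0)
            (B := B) (fun zs hzs η => japaneseWeight_mul_enorm_iterDiff_le hr1 hrq hp.1 hsymb hC₀ zs
              (hzs.trans hlen) η) ξ
          rw [zero_mul, zero_add] at this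
          rw [← mul_pow]
          gcongr
      _ = B ^ 2 * ∫⁻ ξ, weightedMajorant (japaneseWeight 1) (japaneseWeight (q - 1)) fs
            (𝓕 w : SchwartzMap (Ed d) ℂ) ξ ^ 2 :=
          lintegral_const_mul _ ((measurable_weightedMajorant hv hV fs hgm).pow_const 2)
      _ ≤ B ^ 2 * (C₁ * (ENNReal.ofReal ((∏ i, HNorm q (f i)) ^ 2) *
            ENNReal.ofReal (HNorm (q - 1) w ^ 2))) := by
          gcongr
          rw [ofReal_HNorm_sq, ← hprod]
          exact hL2 fs hlen _ hgm
      _ = _ := by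
          rw [ENNReal.ofReal_mul ENNReal.toReal_nonneg, ENNReal.ofReal_toReal hKtop,
            mul_pow (∏ i, HNorm q (f i)), ENNReal.ofReal_mul (sq_nonneg _), mul_assoc (B ^ 2)]
  have hP : 0 ≤ (∏ i, HNorm q (f i)) * HNorm (q - 1) w :=
    mul_nonneg (Finset.prod_nonneg fun i _ => HNorm_nonneg _ _) (HNorm_nonneg _ _)
  rw [ENNReal.ofReal_le_ofReal_iff (mul_nonneg ENNReal.toReal_nonneg (sq_nonneg _))] at hmain
  rw [mul_assoc]
  calc HNorm (q - r) S ≤ √(K * ((∏ i, HNorm q (f i)) * HNorm (q - 1) w) ^ 2) :=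
        Real.le_sqrt_of_sq_le hmain
    _ = √K * ((∏ i, HNorm q (f i)) * HNorm (q - 1) w) := by
        rw [Real.sqrt_mul ENNReal.toReal_nonneg, Real.sqrt_sq hP]
    _ ≤ _ := by gcongr; linarith
end
end
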